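/- arXiv:2504.11656 — 5 statements merged into one kernel-verified Lean document; each statement's English description precedes it below -/
import Mathlib

section
/- Every tree with maximum degree Δ ≥ 3 and ℓ leaves has at least log_{Δ−1}((Δ−2)·ℓ) distinct leaf-to-leaf path lengths. -/
namespace Stmt4Aux

open SimpleGraph

variable {V : Type*} {G : SimpleGraph V}

lemma path_length (hG : G.IsTree) {u v : V} (p : G.Walk u v) (hp : p.IsPath) :
    p.length = G.dist u v := by
  obtain ⟨q, hq, hql⟩ := hG.connected.exists_path_of_dist u v
  have := (hG.existsUnique_path u v).unique hp hq
  rw [this, hql]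

lemma uniq_closer (hG : G.IsTree) {s z a b : V} (ha : G.Adj a z) (hb : G.Adj b z)
    (hda : G.dist s z = G.dist s a + 1) (hdb : G.dist s z = G.dist s b + 1) : a = b := by
  obtain ⟨p, hp, hpl⟩ := hG.connected.exists_path_of_dist s a
  obtain ⟨q, hq, hql⟩ := hG.connected.exists_path_of_dist s b
  have h1 : (p.concat ha).IsPath := by
    apply Walk.isPath_of_length_eq_dist
    rw [Walk.length_concat, hpl, hda]
  have h2 : (q.concat hb).IsPath := by
    apply Walk.isPath_of_length_eq_dist
    rw [Walk.length_concat, hql, hdb]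
  have h3 := (hG.existsUnique_path s z).unique h1 h2
  have := congrArg (fun w : G.Walk s z => w.penultimate) h3
  simpa using this

lemma dist_adj (hG : G.IsTree) (s : V) {a z : V} (h : G.Adj a z) :
    G.dist s z = G.dist s a + 1 ∨ G.dist s a = G.dist s z + 1 := by
  have h1 := hG.dist_ne_of_adj s h
  have h2 := hG.connected.dist_triangle (u := s) (v := a) (w := z)
  have h3 := hG.connected.dist_triangle (u := s) (v := z) (w := a)
  have h4 : G.dist a z = 1 := dist_eq_one_iff_adj.2 h
  have h5 : G.dist z a = 1 := dist_eq_one_iff_adj.2 h.symm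
  omega

lemma exists_closer (hG : G.IsTree) {s z : V} (h : z ≠ s) :
    ∃ a, G.Adj a z ∧ G.dist s z = G.dist s a + 1 := by
  obtain ⟨p, hp, hpl⟩ := hG.connected.exists_path_of_dist z s
  cases p with
  | nil => exact absurd rfl h
  | cons hadj q =>
    rename_i a
    refine ⟨a, hadj.symm, ?_⟩
    have h1 := dist_le q
    rw [Walk.length_cons] at hpl
    rw [dist_comm (u := s) (v := z), dist_comm (u := s) (v := a)]
    rcases dist_adj hG s hadj with h2 | h2
    · rw [dist_comm (u := s) (v := z), dist_comm (u := s) (v := a)] at h2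
      omega
    · rw [dist_comm (u := s) (v := z), dist_comm (u := s) (v := a)] at h2
      omega

lemma other_farther (hG : G.IsTree) {s z a b : V} (ha : G.Adj a z) (hb : G.Adj b z)
    (hab : a ≠ b) (hda : G.dist s z = G.dist s a + 1) : G.dist s b = G.dist s z + 1 := by
  rcases dist_adj hG s hb with h | h
  · exact absurd (uniq_closer hG ha hb hda h) hab
  · exact h

lemma dist_concat (hG : G.IsTree) (s : V) (n : ℕ) : ∀ {z a u : V}, G.Adj a z →
    G.dist s a = G.dist s z + 1 → G.dist u z = n + 1 → G.dist u a = n →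
    G.dist s u = G.dist s z + (n + 1) := by
  induction n with
  | zero =>
    intro z a u _ h1 _ h3
    have : u = a := by
      exact (hG.connected.dist_eq_zero_iff).1 h3
    subst this
    simpa using h1
  | succ n ih =>
    intro z a u haz h1 h2 h3
    have hne : a ≠ u := by
      rintro rfl
      simp at h3
    obtain ⟨b, hba, hb⟩ := exists_closer hG hne
    have hbz : z ≠ b := by
      rintro rfl
      omega
    have := other_farther hG haz.symm hba hbz h1
    have := ih hba this h3 (by omega)
    omega

section par

variable [DecidableEq V]

open Classical in
/-- Parent of a vertex in the tree rooted at `r`. -/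
noncomputable def par (G : SimpleGraph V) (r v : V) : V :=
  if h : ∃ a, G.Adj a v ∧ G.dist r v = G.dist r a + 1 then h.choose else v

lemma par_spec (hG : G.IsTree) {r v : V} (h : v ≠ r) :
    G.Adj (par G r v) v ∧ G.dist r v = G.dist r (par G r v) + 1 := by
  have := exists_closer hG h
  unfold par
  rw [dif_pos this]
  exact this.choose_spec

lemma iter_spec (hG : G.IsTree) {r u : V} (h : ℕ) (hh : h ≤ G.dist r u) :
    G.dist r ((par G r)^[h] u) + h = G.dist r u ∧ G.dist u ((par G r)^[h] u) = h := by
  induction h with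
  | zero => simp
  | succ h ih =>
    obtain ⟨h1, h2⟩ := ih (by omega)
    rw [Function.iterate_succ_apply']
    set x := (par G r)^[h] u with hx
    have hxr : x ≠ r := by
      intro e
      rw [e] at h1
      simp at h1
      omega
    obtain ⟨h3, h4⟩ := par_spec hG hxr
    refine ⟨by omega, ?_⟩
    have h5 := hG.connected.dist_triangle (u := r) (v := par G r x) (w := u)
    have h6 := hG.connected.dist_triangle (u := u) (v := x) (w := par G r x)
    rw [dist_eq_one_iff_adj.2 h3.symm] at h6
    rw [dist_comm (u := par G r x) (v := u)] at h5
    omega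

/-- the key computation at a branching vertex -/
lemma branch (hG : G.IsTree) {r u w s : V} {D h : ℕ} (hu : G.dist r u = D) (hw : G.dist r w = D)
    (hh : h < D) (hne : (par G r)^[h] u ≠ (par G r)^[h] w)
    (he : par G r ((par G r)^[h] u) = par G r ((par G r)^[h] w))
    (hsu : G.dist s u ≤ G.dist s r) (hsw : G.dist s w ≤ G.dist s r) :
    G.dist u w = 2 * (h + 1) ∧ 2 * (h + 1) ≤ D := by
  obtain ⟨a1, a2⟩ := iter_spec hG (r := r) (u := u) h (by omega)
  obtain ⟨b1, b2⟩ := iter_spec hG (r := r) (u := w) h (by omega)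
  obtain ⟨a3, a4⟩ := iter_spec hG (r := r) (u := u) (h + 1) (by omega)
  obtain ⟨b3, b4⟩ := iter_spec hG (r := r) (u := w) (h + 1) (by omega)
  rw [Function.iterate_succ_apply'] at a3 a4 b3 b4
  set x := (par G r)^[h] u
  set y := (par G r)^[h] w
  have hx : x ≠ r := by
    intro e
    rw [e] at a1
    simp at a1
    omega
  have hy : y ≠ r := by
    intro e
    rw [e] at b1
    simp at b1
    omega
  have px := (par_spec hG hx).1.symm
  have py := (par_spec hG hy).1.symm
  rw [← he] at py b3 b4
  set z := par G r x
  constructor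
  · have h1 := other_farther hG px py hne (s := u) (by omega)
    have h2 := dist_concat hG u h py h1 b4 b2
    omega
  · have htri := hG.connected.dist_triangle (u := s) (v := z) (w := r)
    rw [dist_comm (u := z) (v := r)] at htri
    rcases dist_adj hG s px with h1 | h1
    · have h2 := other_farther hG px py hne h1
      have h3 := dist_concat hG s h py h2 b4 b2
      omega
    · have h3 := dist_concat hG s h px h1 a4 a2
      omega

variable [Fintype V] [DecidableRel G.Adj]

lemma fiber_card (hG : G.IsTree) {r : V} {d : ℕ} (hd1 : 1 ≤ d) (hr : G.degree r = 1)
    (hd : ∀ v, G.degree v ≤ d + 1) (B : Finset V) (hB : ∀ x ∈ B, x ≠ r) (z : V) :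
    (B.filter fun x => par G r x = z).card ≤ d := by
  have hsub : (B.filter fun x => par G r x = z) ⊆ G.neighborFinset z := by
    intro x hx
    rw [Finset.mem_filter] at hx
    rw [mem_neighborFinset, ← hx.2]
    exact (par_spec hG (hB x hx.1)).1
  by_cases hz : z = r
  · have := Finset.card_le_card hsub
    rw [card_neighborFinset_eq_degree, hz, hr] at this
    rw [hz]
    omega
  · obtain ⟨h1, h2⟩ := par_spec hG hz
    have hmem : par G r z ∈ G.neighborFinset z := by
      rw [mem_neighborFinset]
      exact h1.symm
    have hsub2 : (B.filter fun x => par G r x = z) ⊆ (G.neighborFinset z).erase (par G r z) := by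
      intro x hx
      rw [Finset.mem_erase]
      refine ⟨?_, hsub hx⟩
      rintro rfl
      rw [Finset.mem_filter] at hx
      have := (par_spec hG (hB _ hx.1)).2
      rw [hx.2] at this
      omega
    have := Finset.card_le_card hsub2
    rw [Finset.card_erase_of_mem hmem, card_neighborFinset_eq_degree] at this
    have := hd z
    omega

lemma level_card (hG : G.IsTree) {r s : V} {d D : ℕ} (hd1 : 1 ≤ d) (hr : G.degree r = 1)
    (hd : ∀ v, G.degree v ≤ d + 1) (A : Finset V) (S : Finset ℕ)
    (hA : ∀ u ∈ A, G.dist r u = D) (hS : ∀ u ∈ A, ∀ w ∈ A, G.dist u w ∈ S)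
    (hs : ∀ u ∈ A, G.dist s u ≤ G.dist s r) (h : ℕ) (hh : h ≤ D) :
    A.card ≤ d ^ (((Finset.range h).filter fun i => 2 * (i + 1) ∈ S ∧ 2 * (i + 1) ≤ D).card) *
      (A.image ((par G r)^[h])).card := by
  induction h with
  | zero => simp
  | succ h ih =>
    refine (ih (by omega)).trans ?_
    have himg : A.image ((par G r)^[h + 1]) = (A.image ((par G r)^[h])).image (par G r) := by
      rw [Finset.image_image, Function.iterate_succ']
    have hB : ∀ x ∈ A.image ((par G r)^[h]), x ≠ r := by
      intro x hx e
      rw [Finset.mem_image] at hx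
      obtain ⟨u, hu, rfl⟩ := hx
      have := (iter_spec hG (r := r) (u := u) h (by rw [hA u hu]; omega)).1
      rw [e, hA u hu] at this
      simp at this
      omega
    rw [himg, Finset.range_add_one, Finset.filter_insert]
    by_cases hc : 2 * (h + 1) ∈ S ∧ 2 * (h + 1) ≤ D
    · rw [if_pos hc, Finset.card_insert_of_notMem (by simp), pow_succ, mul_assoc]
      apply Nat.mul_le_mul_left
      apply Finset.card_le_mul_card_image
      intro z _
      exact fiber_card hG hd1 hr hd _ hB z
    · rw [if_neg hc, Finset.card_image_of_injOn (f := par G r)]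
      intro x hx y hy hxy
      simp only [Finset.coe_image, Set.mem_image, Finset.mem_coe] at hx hy
      obtain ⟨u, hu, rfl⟩ := hx
      obtain ⟨w, hw, rfl⟩ := hy
      by_contra hne
      obtain ⟨h1, h2⟩ := branch hG (hA u hu) (hA w hw) (by omega) hne hxy (hs u hu) (hs w hw)
      exact hc ⟨h1 ▸ hS u hu w hw, h2⟩

end par

lemma sum_rank (d : ℕ) (S : Finset ℕ) :
    ∑ D ∈ S, d ^ ((S.filter fun x => x < D).card) = ∑ i ∈ Finset.range S.card, d ^ i := by
  induction S using Finset.induction_on_max with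
  | empty => simp
  | insert a S hmax ih =>
    have ha : a ∉ S := fun h => lt_irrefl _ (hmax a h)
    rw [Finset.sum_insert ha, Finset.card_insert_of_notMem ha, Finset.sum_range_succ, ← ih,
      add_comm]
    congr 1
    · apply Finset.sum_congr rfl
      intro D hD
      rw [Finset.filter_insert, if_neg (by have := hmax D hD; omega)]
    · rw [Finset.filter_insert, if_neg (lt_irrefl _), Finset.filter_true_of_mem hmax]

lemma rank_le (S : Finset ℕ) (D : ℕ) (h0 : 0 ∈ S) :
    ((Finset.range D).filter fun i => 2 * (i + 1) ∈ S ∧ 2 * (i + 1) ≤ D).card ≤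
      (S.filter fun x => x < D).card := by
  rcases Nat.eq_zero_or_pos D with rfl | hD
  · simp
  · have hsub : ((Finset.range D).filter fun i => 2 * (i + 1) ∈ S ∧ 2 * (i + 1) ≤ D).image
        (fun i => 2 * (i + 1)) ⊆ insert D ((S.filter fun x => x < D).erase 0) := by
      intro x hx
      simp only [Finset.mem_image, Finset.mem_filter, Finset.mem_range] at hx
      obtain ⟨i, ⟨_, h2, h3⟩, rfl⟩ := hx
      simp only [Finset.mem_insert, Finset.mem_erase, Finset.mem_filter]
      by_cases h : 2 * (i + 1) = D
      · exact Or.inl h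
      · exact Or.inr ⟨by omega, h2, by omega⟩
    have h1 := Finset.card_le_card hsub
    rw [Finset.card_image_of_injective _ (fun a b h => by simpa using h)] at h1
    have hmem : 0 ∈ S.filter fun x => x < D := by simp [h0, hD]
    have h2 := Finset.card_insert_le D ((S.filter fun x => x < D).erase 0)
    have h3 := Finset.card_erase_add_one hmem
    omega

lemma leaves_le [Fintype V] [DecidableEq V] [DecidableRel G.Adj] (hG : G.IsTree) {d : ℕ}
    (hd1 : 1 ≤ d) (hd : ∀ v, G.degree v ≤ d + 1) (L : Finset V)
    (hL : ∀ v ∈ L, G.degree v = 1) :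
    L.card ≤ ∑ i ∈ Finset.range ((L ×ˢ L).image fun p => G.dist p.1 p.2).card, d ^ i := by
  rcases L.eq_empty_or_nonempty with rfl | hne
  · simp
  obtain ⟨⟨r, s⟩, hrs, hmax⟩ := Finset.exists_max_image (L ×ˢ L) (fun p => G.dist p.1 p.2)
    (hne.product hne)
  rw [Finset.mem_product] at hrs
  obtain ⟨hr, hs⟩ := hrs
  simp only at hr hs
  set S := (L ×ˢ L).image fun p => G.dist p.1 p.2 with hS
  have hmem : ∀ u ∈ L, ∀ w ∈ L, G.dist u w ∈ S := by
    intro u hu w hw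
    exact Finset.mem_image.2 ⟨(u, w), Finset.mem_product.2 ⟨hu, hw⟩, rfl⟩
  have h0 : 0 ∈ S := by
    have := hmem r hr r hr
    simpa using this
  rw [← sum_rank, Finset.card_eq_sum_card_fiberwise (f := fun u => G.dist r u) (t := S)
    (fun u hu => hmem r hr u hu)]
  apply Finset.sum_le_sum
  intro D hD
  have h1 := level_card hG (s := s) (D := D) hd1 (hL r hr) hd
    (L.filter fun u => G.dist r u = D) S (fun u hu => (Finset.mem_filter.1 hu).2)
    (fun u hu w hw => hmem u (Finset.mem_filter.1 hu).1 w (Finset.mem_filter.1 hw).1)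
    (fun u hu => by
      have := hmax (u, s) (Finset.mem_product.2 ⟨(Finset.mem_filter.1 hu).1, hs⟩)
      rw [dist_comm (u := s) (v := u), dist_comm (u := s) (v := r)]
      exact this) D le_rfl
  have h2 : ((L.filter fun u => G.dist r u = D).image ((par G r)^[D])).card ≤ 1 := by
    have hsub : (L.filter fun u => G.dist r u = D).image ((par G r)^[D]) ⊆ {r} := by
      intro x hx
      obtain ⟨u, hu, rfl⟩ := Finset.mem_image.1 hx
      have hu2 := (Finset.mem_filter.1 hu).2
      have := (iter_spec hG (r := r) (u := u) D (by omega)).1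
      rw [Finset.mem_singleton]
      exact ((hG.connected.dist_eq_zero_iff).1 (by omega)).symm
    simpa using Finset.card_le_card hsub
  refine h1.trans ((Nat.mul_le_mul_left _ h2).trans ?_)
  rw [mul_one]
  exact Nat.pow_le_pow_right hd1 (rank_le S D h0)

end Stmt4Aux

/-- Every tree with maximum degree `Δ ≥ 3` and `ℓ` leaves has at least
`log_{Δ−1} ((Δ−2)·ℓ)` distinct leaf-to-leaf path lengths. -/
theorem stmt4 {V : Type*} [Fintype V] [DecidableEq V] (G : SimpleGraph V)
    [DecidableRel G.Adj] (hG : G.IsTree) (Δ ℓ : ℕ)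
    (hΔ : G.maxDegree = Δ) (hΔ3 : 3 ≤ Δ)
    (hℓ : (Finset.univ.filter fun v => G.degree v = 1).card = ℓ) :
    Real.logb ((Δ : ℝ) - 1) (((Δ : ℝ) - 2) * (ℓ : ℝ)) ≤
      (({ L : ℕ | ∃ (u v : V) (p : G.Walk u v), p.IsPath ∧
          G.degree u = 1 ∧ G.degree v = 1 ∧ p.length = L }).ncard : ℝ) := by
  obtain ⟨d, rfl⟩ : ∃ d, Δ = d + 1 := ⟨Δ - 1, by omega⟩
  set A := Finset.univ.filter fun v => G.degree v = 1 with hA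
  have hset : { L : ℕ | ∃ (u v : V) (p : G.Walk u v), p.IsPath ∧
      G.degree u = 1 ∧ G.degree v = 1 ∧ p.length = L } =
      (((A ×ˢ A).image fun p => G.dist p.1 p.2 : Finset ℕ) : Set ℕ) := by
    ext n
    simp only [Set.mem_ofPred_eq, Finset.coe_image, Set.mem_image, Finset.mem_coe,
      Finset.mem_product, hA, Finset.mem_filter, Finset.mem_univ, true_and, Prod.exists]
    constructor
    · rintro ⟨u, v, p, hp, hu, hv, rfl⟩
      exact ⟨u, v, ⟨hu, hv⟩, (Stmt4Aux.path_length hG p hp).symm⟩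
    · rintro ⟨u, v, ⟨hu, hv⟩, rfl⟩
      obtain ⟨p, hp, hpl⟩ := hG.connected.exists_path_of_dist u v
      exact ⟨u, v, p, hp, hu, hv, hpl⟩
  rw [hset, Set.ncard_coe_finset]
  have key := Stmt4Aux.leaves_le hG (d := d) (by omega)
    (fun v => hΔ ▸ G.degree_le_maxDegree v) A (fun v hv => (Finset.mem_filter.1 hv).2)
  rw [hℓ] at key
  set k := ((A ×ˢ A).image fun p => G.dist p.1 p.2).card
  have hd2 : (2 : ℝ) ≤ d := by
    have : 2 ≤ d := by omega
    exact_mod_cast this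
  have e1 : ((d + 1 : ℕ) : ℝ) - 1 = d := by push_cast; ring
  have e2 : ((d + 1 : ℕ) : ℝ) - 2 = d - 1 := by push_cast; ring
  rw [e1, e2]
  rcases Nat.eq_zero_or_pos ℓ with h0 | hpos
  · rw [h0]
    simp
  · have hposR : (0 : ℝ) < ℓ := by exact_mod_cast hpos
    rw [Real.logb_le_iff_le_rpow (by linarith) (mul_pos (by linarith) hposR), Real.rpow_natCast]
    have keyR : (ℓ : ℝ) ≤ ∑ i ∈ Finset.range k, (d : ℝ) ^ i := by exact_mod_cast key
    have hg := geom_sum_mul (d : ℝ) k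
    nlinarith
end

section
/- Every 1–3 tree on n vertices has at least log₂(n+2) − 1 distinct leaf-to-leaf path lengths. -/
/-- The set of distances occurring in `S`. -/
def distSet5 {V : Type*} (d : V → V → ℕ) (S : Finset V) : Finset ℕ :=
  (S ×ˢ S).image (fun p => d p.1 p.2)

lemma mem_distSet5 {V : Type*} (d : V → V → ℕ) (S : Finset V) (n : ℕ) :
    n ∈ distSet5 d S ↔ ∃ x ∈ S, ∃ y ∈ S, d x y = n := by
  simp only [distSet5, Finset.mem_image, Finset.mem_product, Prod.exists]
  constructor
  · rintro ⟨a, b, ⟨ha, hb⟩, h⟩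
    exact ⟨a, ha, b, hb, h⟩
  · rintro ⟨a, ha, b, hb, h⟩
    exact ⟨a, b, ⟨ha, hb⟩, h⟩

/-- No equilateral triple. -/
def NoTri5 {V : Type*} (d : V → V → ℕ) (S : Finset V) : Prop :=
  ∀ x ∈ S, ∀ y ∈ S, ∀ z ∈ S, 0 < d x y → d x y = d x z → d x y = d y z → False

/-- The abstract metric hypotheses: tree metric of a subcubic tree. -/
structure TreeMet5 {V : Type*} (d : V → V → ℕ) : Prop where
  self : ∀ x, d x x = 0
  eq_of : ∀ x y, d x y = 0 → x = y
  symm : ∀ x y, d x y = d y x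
  four : ∀ x y z w, d x y + d z w ≤ max (d x z + d y w) (d x w + d y z)
  cubic : ∀ x y z w, 0 < d x y → d x y = d x z → d x y = d y z →
    d w x = d w y → d w x = d w z → d x y ≤ d w x → False

lemma distSet5_card_lt {V : Type*} (d : V → V → ℕ) {S T : Finset V} (hT : T ⊆ S) {D : ℕ}
    (hD : D ∈ distSet5 d S) (h : ∀ x ∈ T, ∀ y ∈ T, d x y < D) :
    (distSet5 d T).card < (distSet5 d S).card := by
  apply Finset.card_lt_card
  rw [Finset.ssubset_iff_of_subset]
  · refine ⟨D, hD, ?_⟩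
    rw [mem_distSet5]
    rintro ⟨x, hx, y, hy, hxy⟩
    have := h x hx y hy
    omega
  · intro n
    rw [mem_distSet5, mem_distSet5]
    rintro ⟨x, hx, y, hy, hxy⟩
    exact ⟨x, hT hx, y, hT hy, hxy⟩

set_option maxHeartbeats 2000000 in
lemma split5 {V : Type*} [DecidableEq V] {d : V → V → ℕ} (hd : TreeMet5 d) (S : Finset V)
    (hS : 1 < S.card) :
    ∃ I P Q R : Finset V, P.Nonempty ∧ Q.Nonempty ∧
      S.card ≤ I.card + P.card + Q.card + R.card ∧
      (NoTri5 d S → R = ∅) ∧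
      ∀ X, X = P ∨ X = Q ∨ X = R → I ∪ X ⊆ S ∧ I.card + X.card ≤ (I ∪ X).card ∧
        (distSet5 d (I ∪ X)).card < (distSet5 d S).card ∧
        (distSet5 d X).card < (distSet5 d S).card ∧ NoTri5 d X := by
  obtain ⟨a, ha, b, hb, hab⟩ := Finset.one_lt_card.mp hS
  have hne : (S ×ˢ S).Nonempty := ⟨(a, b), by simp [ha, hb]⟩
  obtain ⟨⟨p, q⟩, hpq, hmax⟩ := Finset.exists_max_image (S ×ˢ S) (fun p => d p.1 p.2) hne
  obtain ⟨D, hD⟩ : ∃ D, D = d p q := ⟨_, rfl⟩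
  have hp : p ∈ S := (Finset.mem_product.mp hpq).1
  have hq : q ∈ S := (Finset.mem_product.mp hpq).2
  have hle : ∀ x ∈ S, ∀ y ∈ S, d x y ≤ D := by
    intro x hx y hy
    have := hmax (x, y) (by simp [hx, hy])
    simpa [hD] using this
  have hDpos : 0 < D := by
    have h1 := hle a ha b hb
    have h2 : d a b ≠ 0 := fun h => hab (hd.eq_of _ _ h)
    omega
  have hDS : D ∈ distSet5 d S := (mem_distSet5 _ _ _).2 ⟨p, hp, q, hq, hD.symm⟩
  classical
  set O : V → Prop := fun x => ∃ y ∈ S, d x y = D with hO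
  have trans' : ∀ x ∈ S, ∀ y ∈ S, ∀ z ∈ S, O y → d x y < D → d y z < D → d x z < D := by
    rintro x hx y hy z hz ⟨y', hy', hyy⟩ h1 h2
    by_contra h3
    have := hd.four x z y y'
    have e1 := hle x hx y' hy'
    have e2 := hle z hz y' hy'
    have e3 := hd.symm z y
    omega
  have hOp : O p := ⟨q, hq, hD.symm⟩
  have hOq : O q := ⟨p, hp, by rw [hd.symm]; exact hD.symm⟩
  have hsymm := hd.symm
  let I := S.filter (fun x => ¬ O x)
  let P := S.filter (fun x => O x ∧ d x p < D)
  let Q := S.filter (fun x => O x ∧ d x q < D)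
  let R := S.filter (fun x => O x ∧ d x p = D ∧ d x q = D)
  have key : ∀ X : Finset V, (∀ x ∈ X, x ∈ S ∧ O x) → (∀ x ∈ X, ∀ y ∈ X, d x y < D) →
      (∃ w ∈ S, ∀ x ∈ X, d x w = D) →
      I ∪ X ⊆ S ∧ I.card + X.card ≤ (I ∪ X).card ∧
        (distSet5 d (I ∪ X)).card < (distSet5 d S).card ∧
        (distSet5 d X).card < (distSet5 d S).card ∧ NoTri5 d X := by
    intro X hX hlt hw
    have hsub : I ∪ X ⊆ S := by
      intro x hx
      rcases Finset.mem_union.1 hx with h | h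
      · exact (Finset.mem_filter.1 h).1
      · exact (hX x h).1
    have hlt' : ∀ x ∈ I ∪ X, ∀ y ∈ I ∪ X, d x y < D := by
      intro x hx y hy
      have hxS := hsub hx
      have hyS := hsub hy
      have h1 := hle x hxS y hyS
      by_contra hcon
      have h2 : d x y = D := by omega
      rcases Finset.mem_union.1 hx with h | h
      · exact (Finset.mem_filter.1 h).2 ⟨y, hyS, h2⟩
      · rcases Finset.mem_union.1 hy with h' | h'
        · exact (Finset.mem_filter.1 h').2 ⟨x, hxS, by rw [hsymm]; exact h2⟩
        · have := hlt x h y h'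
          omega
    refine ⟨hsub, ?_, distSet5_card_lt d hsub hDS hlt',
      distSet5_card_lt d (fun x hx => (hX x hx).1) hDS hlt, ?_⟩
    · rw [Finset.card_union_of_disjoint]
      rw [Finset.disjoint_left]
      intro x hx hx'
      exact (Finset.mem_filter.1 hx).2 (hX x hx').2
    · intro x hx y hy z hz h0 h1 h2
      obtain ⟨w, hw, hw'⟩ := hw
      have e1 := hw' x hx
      have e2 := hw' y hy
      have e3 := hw' z hz
      have e4 := hlt x hx y hy
      rw [hsymm] at e1 e2 e3
      exact hd.cubic x y z w h0 h1 h2 (by omega) (by omega) (by omega)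
  have memP : ∀ x, x ∈ P ↔ x ∈ S ∧ O x ∧ d x p < D := fun x => by simp [P]
  have memQ : ∀ x, x ∈ Q ↔ x ∈ S ∧ O x ∧ d x q < D := fun x => by simp [Q]
  have memR : ∀ x, x ∈ R ↔ x ∈ S ∧ O x ∧ d x p = D ∧ d x q = D := fun x => by simp [R]
  refine ⟨I, P, Q, R, ⟨p, (memP p).2 ⟨hp, hOp, by rw [hd.self]; exact hDpos⟩⟩,
    ⟨q, (memQ q).2 ⟨hq, hOq, by rw [hd.self]; exact hDpos⟩⟩, ?_, ?_, ?_⟩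
  · have : S ⊆ I ∪ P ∪ Q ∪ R := by
      intro x hx
      have h1 := hle x hx p hp
      have h2 := hle x hx q hq
      simp only [Finset.mem_union, memP, memQ, memR, hx, true_and]
      by_cases hOx : O x
      · rcases h1.lt_or_eq with h | h
        · exact Or.inl (Or.inl (Or.inr ⟨hOx, h⟩))
        · rcases h2.lt_or_eq with h' | h'
          · exact Or.inl (Or.inr ⟨hOx, h'⟩)
          · exact Or.inr ⟨hOx, h, h'⟩
      · exact Or.inl (Or.inl (Or.inl (Finset.mem_filter.2 ⟨hx, hOx⟩)))
    have h0 := Finset.card_le_card this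
    have h1 := Finset.card_union_le (I ∪ P ∪ Q) R
    have h2 := Finset.card_union_le (I ∪ P) Q
    have h3 := Finset.card_union_le I P
    omega
  · intro hno
    rw [Finset.eq_empty_iff_forall_notMem]
    intro x hx
    obtain ⟨hxS, -, h1, h2⟩ := (memR x).1 hx
    exact hno x hxS p hp q hq (by omega) (by omega) (by omega)
  · rintro X (rfl | rfl | rfl)
    · refine key P (fun x hx => ⟨((memP x).1 hx).1, ((memP x).1 hx).2.1⟩) ?_ ⟨q, hq, ?_⟩
      · intro x hx y hy
        obtain ⟨h1, h2, h3⟩ := (memP x).1 hx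
        obtain ⟨h4, h5, h6⟩ := (memP y).1 hy
        exact trans' x h1 p hp y h4 hOp h3 (by rw [hsymm]; exact h6)
      · intro x hx
        obtain ⟨h1, h2, h3⟩ := (memP x).1 hx
        by_contra hne
        have h4 := hle x h1 q hq
        have := trans' p hp x h1 q hq h2 (by rw [hsymm]; exact h3) (by omega)
        omega
    · refine key Q (fun x hx => ⟨((memQ x).1 hx).1, ((memQ x).1 hx).2.1⟩) ?_ ⟨p, hp, ?_⟩
      · intro x hx y hy
        obtain ⟨h1, h2, h3⟩ := (memQ x).1 hx
        obtain ⟨h4, h5, h6⟩ := (memQ y).1 hy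
        exact trans' x h1 q hq y h4 hOq h3 (by rw [hsymm]; exact h6)
      · intro x hx
        obtain ⟨h1, h2, h3⟩ := (memQ x).1 hx
        by_contra hne
        have h4 := hle x h1 p hp
        have := trans' p hp x h1 q hq h2 (by rw [hsymm]; omega) h3
        omega
    · refine key R (fun x hx => ⟨((memR x).1 hx).1, ((memR x).1 hx).2.1⟩) ?_
        ⟨p, hp, fun x hx => ((memR x).1 hx).2.2.1⟩
      intro x hx y hy
      obtain ⟨h1, h2, h3, h3'⟩ := (memR x).1 hx
      obtain ⟨h4, h5, h6, h6'⟩ := (memR y).1 hy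
      by_contra hcon
      have h7 := hle x h1 y h4
      have e1 := hsymm q p
      have e2 := hsymm q x
      have e3 := hsymm q y
      have e4 := hsymm p x
      have e5 := hsymm p y
      exact hd.cubic x y p q (by omega) (by omega) (by omega) (by omega) (by omega) (by omega)

lemma distSet5_pos {V : Type*} {d : V → V → ℕ} {S : Finset V} (hS : S.Nonempty) :
    0 < (distSet5 d S).card := by
  obtain ⟨x, hx⟩ := hS
  exact Finset.card_pos.2 ⟨d x x, (mem_distSet5 _ _ _).2 ⟨x, hx, x, hx, rfl⟩⟩

lemma noTri_bound5 {V : Type*} [DecidableEq V] {d : V → V → ℕ} (hd : TreeMet5 d) (k : ℕ) :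
    ∀ S : Finset V, S.Nonempty → NoTri5 d S → (distSet5 d S).card ≤ k →
      2 * S.card ≤ 2 ^ k := by
  induction k with
  | zero =>
    intro S hS _ h
    have := distSet5_pos (d := d) hS
    omega
  | succ k ih =>
    intro S hS hno hk
    have h1 : 2 ^ (k + 1) = 2 * 2 ^ k := by ring
    by_cases hc : 1 < S.card
    · obtain ⟨I, P, Q, R, hPn, hQn, hcard, hR, hX⟩ := split5 hd S hc
      have hR0 := hR hno
      have sub : ∀ X, X.Nonempty → (X = P ∨ X = Q ∨ X = R) →
          2 * (I.card + X.card) ≤ 2 ^ k := by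
        intro X hXn hXe
        obtain ⟨a1, a2, a3, a4, a5⟩ := hX X hXe
        have := ih (I ∪ X) (hXn.mono Finset.subset_union_right)
          (fun x hx y hy z hz => hno x (a1 hx) y (a1 hy) z (a1 hz)) (by omega)
        omega
      have e1 := sub P hPn (by simp)
      have e2 := sub Q hQn (by simp)
      have : R.card = 0 := by simp [hR0]
      omega
    · have : 0 < 2 ^ k := by positivity
      omega

lemma bound5 {V : Type*} [DecidableEq V] {d : V → V → ℕ} (hd : TreeMet5 d) (k : ℕ) :
    ∀ S : Finset V, (distSet5 d S).card ≤ k → S.card ≤ 2 ^ k := by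
  induction k with
  | zero =>
    intro S hk
    rcases S.eq_empty_or_nonempty with rfl | h
    · simp
    · have := distSet5_pos (d := d) h
      omega
  | succ k ih =>
    intro S hk
    have h1 : 2 ^ (k + 1) = 2 * 2 ^ k := by ring
    by_cases hc : 1 < S.card
    · obtain ⟨I, P, Q, R, hPn, hQn, hcard, hR, hX⟩ := split5 hd S hc
      have sub : ∀ X, (X = P ∨ X = Q ∨ X = R) →
          I.card + X.card ≤ 2 ^ k ∧ 2 * X.card ≤ 2 ^ k := by
        intro X hXe
        obtain ⟨a1, a2, a3, a4, a5⟩ := hX X hXe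
        have := ih (I ∪ X) (by omega)
        refine ⟨by omega, ?_⟩
        rcases X.eq_empty_or_nonempty with h | h
        · simp [h]
        · exact noTri_bound5 hd k X h a5 (by omega)
      have e1 := sub P (by simp)
      have e2 := sub Q (by simp)
      have e3 := sub R (by simp)
      omega
    · have : 0 < 2 ^ k := by positivity
      omega

section tree
open SimpleGraph

lemma path_length5 {V : Type*} {G : SimpleGraph V} (hG : G.IsTree) {u v : V}
    (p : G.Walk u v) (hp : p.IsPath) : p.length = G.dist u v := by
  obtain ⟨q, hq, hq'⟩ := hG.connected.exists_path_of_dist u v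
  have := hG.isAcyclic.path_unique ⟨p, hp⟩ ⟨q, hq⟩
  have h : p = q := congrArg Subtype.val this
  rw [h, hq']

lemma path_mem5 {V : Type*} {G : SimpleGraph V} (hG : G.IsTree) {u v w : V}
    (p : G.Walk u v) (hp : p.IsPath) (hw : w ∈ p.support) :
    G.dist u w + G.dist w v = G.dist u v := by
  obtain ⟨q, r, hq, hr, h⟩ := hp.mem_support_iff_exists_append.1 hw
  rw [← path_length5 hG p hp, ← path_length5 hG q hq, ← path_length5 hG r hr, h,
    Walk.length_append]

lemma append_path5 {V : Type*} {G : SimpleGraph V} {u v w : V}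
    (p : G.Walk u v) (q : G.Walk v w) (hp : p.IsPath) (hq : q.IsPath)
    (h : ∀ x ∈ p.support, x ∈ q.support → x = v) : (p.append q).IsPath := by
  rw [Walk.isPath_def, Walk.support_append, List.nodup_append]
  refine ⟨hp.support_nodup, hq.support_nodup.tail, ?_⟩
  rintro a ha b hb rfl
  have h1 := h a ha (List.mem_of_mem_tail hb)
  subst h1
  have h2 := hq.support_nodup
  rw [Walk.support_eq_cons] at h2
  exact (List.nodup_cons.1 h2).1 hb

/-- Projection of `x` on the path `p`. -/
lemma proj5 {V : Type*} {G : SimpleGraph V} (hG : G.IsTree) {y z : V} (x : V)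
    (p : G.Walk y z) (hp : p.IsPath) :
    ∃ m ∈ p.support, G.dist x y = G.dist x m + G.dist m y ∧
      G.dist x z = G.dist x m + G.dist m z := by
  classical
  obtain ⟨m, hm, hmin⟩ := Finset.exists_min_image p.support.toFinset (fun m => G.dist x m)
    ⟨y, by simp⟩
  rw [List.mem_toFinset] at hm
  refine ⟨m, hm, ?_⟩
  obtain ⟨r, hr, hr'⟩ := hG.connected.exists_path_of_dist x m
  have hx : ∀ v ∈ r.support, v ∈ p.support → v = m := by
    intro v hv hv'
    have h1 := path_mem5 hG r hr hv
    have h2 := hmin v (by simpa using hv')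
    have h3 : G.dist v m = 0 := by
      omega
    exact (hG.connected.dist_eq_zero_iff).1 h3
  obtain ⟨q, s, hq, hs, h⟩ := hp.mem_support_iff_exists_append.1 hm
  have hqs : ∀ v ∈ q.support, v ∈ p.support := by
    intro v hv; rw [h, Walk.mem_support_append_iff]; exact Or.inl hv
  have hss : ∀ v ∈ s.support, v ∈ p.support := by
    intro v hv; rw [h, Walk.mem_support_append_iff]; exact Or.inr hv
  constructor
  · have := append_path5 r q.reverse hr hq.reverse
      (fun v hv hv' => hx v hv (hqs v (by simpa using hv')))
    rw [← path_length5 hG _ this, Walk.length_append, path_length5 hG r hr,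
      path_length5 hG _ hq.reverse]
  · have := append_path5 r s hr hs (fun v hv hv' => hx v hv (hss v hv'))
    rw [← path_length5 hG _ this, Walk.length_append, path_length5 hG r hr,
      path_length5 hG _ hs]

lemma four5 {V : Type*} {G : SimpleGraph V} (hG : G.IsTree) (x y z w : V) :
    G.dist x y + G.dist z w ≤
      max (G.dist x z + G.dist y w) (G.dist x w + G.dist y z) := by
  obtain ⟨p, hp, -⟩ := hG.connected.exists_path_of_dist x y
  obtain ⟨m, hm, m1, m2⟩ := proj5 hG z p hp
  obtain ⟨n, hn, n1, n2⟩ := proj5 hG w p hp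
  have a1 := path_mem5 hG p hp hm
  have a2 := path_mem5 hG p hp hn
  have t1 : G.dist z w ≤ G.dist z m + G.dist m w := hG.connected.dist_triangle
  have t2 : G.dist m w ≤ G.dist m n + G.dist n w := hG.connected.dist_triangle
  have c1 := G.dist_comm (u := x) (v := z)
  have c2 := G.dist_comm (u := x) (v := w)
  have c3 := G.dist_comm (u := y) (v := z)
  have c4 := G.dist_comm (u := y) (v := w)
  have c5 := G.dist_comm (u := x) (v := m)
  have c6 := G.dist_comm (u := x) (v := n)
  have c7 := G.dist_comm (u := m) (v := n)
  have c8 := G.dist_comm (u := w) (v := n)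
  obtain ⟨q, s, hq, hs, h⟩ := hp.mem_support_iff_exists_append.1 hm
  rw [h, Walk.mem_support_append_iff] at hn
  rcases hn with hn | hn
  · have := path_mem5 hG q hq hn
    omega
  · have := path_mem5 hG s hs hn
    omega

lemma nbr5 {V : Type*} {G : SimpleGraph V} (hG : G.IsTree) (m x : V) (h : m ≠ x) :
    ∃ x', G.Adj m x' ∧ G.dist x' x + 1 = G.dist m x := by
  obtain ⟨p, hp, hl⟩ := hG.connected.exists_path_of_dist m x
  cases p with
  | nil => exact absurd rfl h
  | cons hadj q =>
    refine ⟨_, hadj, ?_⟩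
    rw [← hl, Walk.length_cons, path_length5 hG q hp.of_cons]

lemma cubic5 {V : Type*} [Fintype V] [DecidableEq V] {G : SimpleGraph V}
    [DecidableRel G.Adj] (hG : G.IsTree) (hdeg : ∀ v : V, G.degree v ≤ 3) (x y z w : V)
    (h0 : 0 < G.dist x y) (h1 : G.dist x y = G.dist x z) (h2 : G.dist x y = G.dist y z)
    (h3 : G.dist w x = G.dist w y) (h4 : G.dist w x = G.dist w z)
    (h5 : G.dist x y ≤ G.dist w x) : False := by
  obtain ⟨p, hp, -⟩ := hG.connected.exists_path_of_dist y z
  obtain ⟨m, hm, m1, m2⟩ := proj5 hG x p hp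
  have m3 := path_mem5 hG p hp hm
  have c1 := G.dist_comm (u := x) (v := m)
  have c2 := G.dist_comm (u := y) (v := m)
  have c3 := G.dist_comm (u := w) (v := m)
  have nx : m ≠ x := by
    rintro rfl
    have : G.dist m m = 0 := by simp
    omega
  have ny : m ≠ y := by
    rintro rfl
    have : G.dist m m = 0 := by simp
    omega
  have nz : m ≠ z := by
    rintro rfl
    have : G.dist m m = 0 := by simp
    omega
  have nw : m ≠ w := by
    rintro rfl
    omega
  obtain ⟨x', ax, dx⟩ := nbr5 hG m x nx
  obtain ⟨y', ay, dy⟩ := nbr5 hG m y ny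
  obtain ⟨z', az, dz⟩ := nbr5 hG m z nz
  obtain ⟨w', aw, dw⟩ := nbr5 hG m w nw
  have tri : ∀ a b c : V, G.dist a b ≤ G.dist c a + G.dist c b := by
    intro a b c
    rw [G.dist_comm (u := c) (v := a)]
    exact hG.connected.dist_triangle
  have hxy : x' ≠ y' := by
    rintro rfl
    have := tri x y x'
    omega
  have hxz : x' ≠ z' := by
    rintro rfl
    have := tri x z x'
    omega
  have hyz : y' ≠ z' := by
    rintro rfl
    have := tri y z y'
    omega
  have f := four5 hG w m y z
  have hwx : w' ≠ x' := by
    rintro rfl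
    have := tri w x w'
    omega
  have hwy : w' ≠ y' := by
    rintro rfl
    have := tri w y w'
    omega
  have hwz : w' ≠ z' := by
    rintro rfl
    have := tri w z w'
    omega
  have hsub : ({w', x', y', z'} : Finset V) ⊆ G.neighborFinset m := by
    intro v hv
    simp only [Finset.mem_insert, Finset.mem_singleton] at hv
    rw [mem_neighborFinset]
    rcases hv with rfl | rfl | rfl | rfl <;> assumption
  have hc := Finset.card_le_card hsub
  rw [card_neighborFinset_eq_degree] at hc
  have : ({w', x', y', z'} : Finset V).card = 4 := by
    rw [Finset.card_insert_of_notMem, Finset.card_insert_of_notMem,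
      Finset.card_insert_of_notMem, Finset.card_singleton] <;> simp [*]
  have := hdeg m
  omega

lemma treeMet5 {V : Type*} [Fintype V] [DecidableEq V] {G : SimpleGraph V}
    [DecidableRel G.Adj] (hG : G.IsTree) (hdeg : ∀ v : V, G.degree v ≤ 3) :
    TreeMet5 (fun x y => G.dist x y) where
  self := by simp
  eq_of := fun x y h => (hG.connected.dist_eq_zero_iff).1 h
  symm := fun x y => G.dist_comm
  four := four5 hG
  cubic := cubic5 hG hdeg

end tree

/-- Every 1–3 tree on `n` vertices has at least `log₂(n+2) − 1` distinct
leaf-to-leaf path lengths. -/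
theorem stmt5 {V : Type*} [Fintype V] [DecidableEq V] (G : SimpleGraph V)
    [DecidableRel G.Adj] (hG : G.IsTree)
    (hdeg : ∀ v : V, G.degree v = 1 ∨ G.degree v = 3) :
    Real.logb 2 ((Fintype.card V : ℝ) + 2) - 1 ≤
      (({ L : ℕ | ∃ (u v : V) (p : G.Walk u v), p.IsPath ∧
          G.degree u = 1 ∧ G.degree v = 1 ∧ p.length = L }).ncard : ℝ) := by
  have hd := treeMet5 hG (fun v => by rcases hdeg v with h | h <;> omega)
  set S : Finset V := Finset.univ.filter (fun v => G.degree v = 1) with hS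
  have hset : { L : ℕ | ∃ (u v : V) (p : G.Walk u v), p.IsPath ∧
      G.degree u = 1 ∧ G.degree v = 1 ∧ p.length = L } =
      (distSet5 (fun x y => G.dist x y) S : Set ℕ) := by
    ext L
    rw [Finset.mem_coe, mem_distSet5]
    simp only [Set.mem_setOf_eq, hS, Finset.mem_filter, Finset.mem_univ, true_and]
    constructor
    · rintro ⟨u, v, p, hp, hu, hv, rfl⟩
      exact ⟨u, hu, v, hv, (path_length5 hG p hp).symm⟩
    · rintro ⟨u, hu, v, hv, rfl⟩
      obtain ⟨p, hp, hl⟩ := hG.connected.exists_path_of_dist u v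
      exact ⟨u, v, p, hp, hu, hv, hl⟩
  rw [hset, Set.ncard_coe_finset]
  have hb := bound5 hd _ S le_rfl
  have hcard : 2 * S.card = Fintype.card V + 2 := by
    have e1 := G.sum_degrees_eq_twice_card_edges
    have e2 := hG.card_edgeFinset
    have e3 : ∑ v, (G.degree v + 2 * (if G.degree v = 1 then 1 else 0)) = ∑ v : V, 3 := by
      apply Finset.sum_congr rfl
      intro v _
      rcases hdeg v with h | h <;> simp [h]
    have e4 : S.card = ∑ v, (if G.degree v = 1 then 1 else 0) := Finset.card_filter _ _
    rw [Finset.sum_add_distrib, ← Finset.mul_sum, ← e4, e1] at e3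
    simp only [Finset.sum_const, Finset.card_univ, smul_eq_mul] at e3
    omega
  set k := (distSet5 (fun x y => G.dist x y) S).card
  have hle : (Fintype.card V : ℝ) + 2 ≤ 2 ^ (k + 1) := by
    have : Fintype.card V + 2 ≤ 2 ^ (k + 1) := by
      rw [pow_succ]; omega
    exact_mod_cast this
  have h2 : Real.logb 2 ((Fintype.card V : ℝ) + 2) ≤ Real.logb 2 ((2 : ℝ) ^ (k + 1)) :=
    Real.logb_le_logb_of_le (by norm_num) (by positivity) hle
  rw [Real.logb_pow, Real.logb_self_eq_one (by norm_num)] at h2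
  push_cast at h2
  linarith
end

section
/- Let Δ ≥ 3 and let T be a tree rooted at r with maximum degree at most Δ such that the root r has degree at most Δ−1. Suppose there are m distinct leaves x_1, ..., x_m all at distance a from r, for some a ≥ 1. Then some leaf x_i witnesses at least log_{Δ−1}(m) + 1 distinct leaf-to-leaf path lengths in [0, 2a]. -/
/-- Combinatorial core: iterated fibres of a parent map `p` with depth function `dep`. -/
theorem core_branch {V : Type*} [Fintype V] [DecidableEq V] (p : V → V) (dep : V → ℕ) (D a : ℕ)
    (hdep : ∀ w, 0 < dep w → dep (p w) + 1 = dep w)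
    (hfib : ∀ v, (Finset.univ.filter (fun w => 0 < dep w ∧ p w = v)).card ≤ D)
    (hD : 1 ≤ D) :
    ∀ j, j ≤ a → ∀ (S : Finset V) (v : V), S.Nonempty → (∀ y ∈ S, dep y = a) →
      (∀ y ∈ S, p^[j] y = v) →
      ∃ x ∈ S, ∃ K : Finset ℕ, S.card ≤ D ^ K.card ∧
        ∀ k ∈ K, 1 ≤ k ∧ k ≤ j ∧ ∃ y ∈ S, p^[k] x = p^[k] y ∧ ∀ i < k, p^[i] x ≠ p^[i] y := by
  have hit : ∀ j y, j ≤ dep y → dep (p^[j] y) + j = dep y := by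
    intro j
    induction j with
    | zero => intro y _; simp
    | succ j ih =>
      intro y hy
      have h1 := ih y (by omega)
      rw [Function.iterate_succ_apply']
      have h2 := hdep (p^[j] y) (by omega)
      omega
  intro j
  induction j with
  | zero =>
    intro _ S v hS _ hv
    obtain ⟨x, hx⟩ := hS
    refine ⟨x, hx, ∅, ?_, by simp⟩
    simp only [Finset.card_empty, pow_zero]
    rw [Finset.card_le_one]
    intro b hb c hc
    have h1 := hv b hb
    have h2 := hv c hc
    simp at h1 h2
    rw [h1, h2]
  | succ j ih =>
    intro hj S v hS hSa hv
    set C := S.image (p^[j]) with hC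
    have hCD : C.card ≤ D := by
      refine le_trans (Finset.card_le_card ?_) (hfib v)
      intro w hw
      obtain ⟨y, hy, rfl⟩ := Finset.mem_image.1 hw
      have h1 := hit j y (by rw [hSa y hy]; omega)
      have h2 := hSa y hy
      have h3 := hv y hy
      rw [Function.iterate_succ_apply'] at h3
      simp only [Finset.mem_filter, Finset.mem_univ, true_and]
      exact ⟨by omega, h3⟩
    have hCne : C.Nonempty := hS.image _
    obtain ⟨c, hc, hmaxc⟩ := Finset.exists_max_image C
      (fun c => (S.filter (fun y => p^[j] y = c)).card) hCne
    set S' := S.filter (fun y => p^[j] y = c) with hS'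
    have hsub : S' ⊆ S := Finset.filter_subset _ _
    have hS'ne : S'.Nonempty := by
      obtain ⟨y, hy, hyc⟩ := Finset.mem_image.1 hc
      exact ⟨y, Finset.mem_filter.2 ⟨hy, hyc⟩⟩
    have hcard : S.card ≤ C.card * S'.card := by
      rw [Finset.card_eq_sum_card_image (p^[j]) S, ← smul_eq_mul]
      exact Finset.sum_le_card_nsmul _ _ _ hmaxc
    obtain ⟨x, hx, K, hK, hKp⟩ := ih (by omega) S' c hS'ne (fun y hy => hSa y (hsub hy))
      (fun y hy => (Finset.mem_filter.1 hy).2)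
    by_cases h1 : C.card ≤ 1
    · refine ⟨x, hsub hx, K, ?_, ?_⟩
      · calc S.card ≤ C.card * S'.card := hcard
          _ ≤ 1 * S'.card := Nat.mul_le_mul_right _ h1
          _ ≤ _ := by simpa using hK
      · intro k hk
        obtain ⟨h1, h2, y, hy, h3⟩ := hKp k hk
        exact ⟨h1, by omega, y, hsub hy, h3⟩
    · obtain ⟨c', hc', hne⟩ := Finset.exists_mem_ne (by omega : 1 < C.card) c
      obtain ⟨y, hy, hyc⟩ := Finset.mem_image.1 hc'
      have hxc : p^[j] x = c := (Finset.mem_filter.1 hx).2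
      refine ⟨x, hsub hx, insert (j+1) K, ?_, ?_⟩
      · rw [Finset.card_insert_of_notMem, pow_succ, mul_comm]
        · exact hcard.trans (Nat.mul_le_mul hCD hK)
        · intro h
          have := (hKp _ h).2.1
          omega
      · intro k hk
        rcases Finset.mem_insert.1 hk with rfl | hk
        · refine ⟨by omega, le_rfl, y, hy, by rw [hv x (hsub hx), hv y hy], ?_⟩
          intro i hi heq
          apply hne
          rw [← hyc, ← hxc]
          have : j = (j - i) + i := by omega
          rw [this, Function.iterate_add_apply, Function.iterate_add_apply, heq]
        · obtain ⟨h1, h2, y, hy, h3⟩ := hKp k hk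
          exact ⟨h1, by omega, y, hsub hy, h3⟩

/-- Going up `k` steps and down `k` steps gives a path. -/
theorem updown_path {V : Type*} (G : SimpleGraph V) (p : V → V) (dep : V → ℕ)
    (hdep : ∀ w, 0 < dep w → dep (p w) + 1 = dep w)
    (hadj : ∀ w, 0 < dep w → G.Adj w (p w)) :
    ∀ k (x y : V), k ≤ dep x → dep x = dep y → p^[k] x = p^[k] y →
      (∀ i < k, p^[i] x ≠ p^[i] y) →
      ∃ q : G.Walk x y, q.IsPath ∧ q.length = 2 * k ∧ ∀ z ∈ q.support, dep z ≤ dep x := by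
  intro k
  induction k with
  | zero =>
    intro x y _ _ h _
    simp at h
    subst h
    exact ⟨SimpleGraph.Walk.nil, by simp, by simp, by simp⟩
  | succ k ih =>
    intro x y hk hxy h hne
    have hx := hdep x (by omega)
    have hy := hdep y (by omega)
    obtain ⟨q, hq, hl, hs⟩ := ih (p x) (p y) (by omega) (by omega)
      (by simpa [Function.iterate_succ_apply] using h)
      (fun i hi => by
        have := hne (i+1) (by omega)
        simpa [Function.iterate_succ_apply] using this)
    have hx0 : x ≠ y := by simpa using hne 0 (by omega)
    have hxq : x ∉ q.support := fun hm => by have := hs x hm; omega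
    have hyq : y ∉ q.support := fun hm => by have := hs y hm; omega
    refine ⟨SimpleGraph.Walk.cons (hadj x (by omega)) (q.concat (hadj y (by omega)).symm),
      ?_, ?_, ?_⟩
    · rw [SimpleGraph.Walk.cons_isPath_iff]
      refine ⟨hq.concat hyq _, ?_⟩
      rw [SimpleGraph.Walk.support_concat]
      simp [hxq, hx0]
    · simp [hl]; ring
    · intro z hz
      simp only [SimpleGraph.Walk.support_cons, SimpleGraph.Walk.support_concat,
        List.concat_eq_append, List.mem_cons, List.mem_append, List.not_mem_nil, or_false] at hz
      rcases hz with rfl | hz | rfl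
      · exact le_rfl
      · have := hs z hz; omega
      · omega


/-- As in the previous lemma, but with the root having degree at most `Δ − 1`:
some leaf `x i` witnesses at least `log_{Δ−1}(m) + 1` distinct leaf-to-leaf
path lengths in `[0, 2a]`. -/
theorem stmt8 {V : Type*} [Fintype V] [DecidableEq V] (G : SimpleGraph V)
    [DecidableRel G.Adj] (hG : G.IsTree) (r : V) (Δ m a : ℕ)
    (hΔ : 3 ≤ Δ) (hmax : G.maxDegree ≤ Δ) (hroot : G.degree r ≤ Δ - 1)
    (hm : 1 ≤ m) (ha : 1 ≤ a)
    (x : Fin m → V) (hinj : Function.Injective x)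
    (hleaf : ∀ i, G.degree (x i) = 1) (hdist : ∀ i, G.dist r (x i) = a) :
    ∃ i : Fin m,
      Real.logb ((Δ : ℝ) - 1) (m : ℝ) + 1 ≤
        (({ L : ℕ | L ≤ 2 * a ∧ ∃ (v : V) (p : G.Walk (x i) v),
            p.IsPath ∧ G.degree v = 1 ∧ p.length = L }).ncard : ℝ) := by
  classical
  have hpar : ∀ w, ∃ u, 0 < G.dist r w → G.Adj w u ∧ G.dist r u + 1 = G.dist r w := by
    intro w
    obtain ⟨q, hq⟩ := hG.connected.exists_walk_length_eq_dist w r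
    cases q with
    | nil => exact ⟨r, fun h => by simp at h⟩
    | cons hh t =>
      rename_i u
      refine ⟨u, fun _ => ⟨hh, ?_⟩⟩
      have h1 : G.dist u r ≤ t.length := SimpleGraph.dist_le t
      have h2 : G.dist w r ≤ G.dist w u + G.dist u r := hG.connected.dist_triangle
      have h3 : G.dist w u = 1 := SimpleGraph.dist_eq_one_iff_adj.2 hh
      rw [SimpleGraph.Walk.length_cons] at hq
      rw [SimpleGraph.dist_comm, SimpleGraph.dist_comm (u := r) (v := w)]
      omega
  choose p hp using hpar
  have hfib : ∀ v, (Finset.univ.filter (fun w => 0 < G.dist r w ∧ p w = v)).card ≤ Δ - 1 := by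
    intro v
    by_cases hv : v = r
    · refine le_trans (Finset.card_le_card ?_) hroot
      intro w hw
      simp only [Finset.mem_filter, Finset.mem_univ, true_and] at hw
      obtain ⟨h0, h1⟩ := hw
      have := (hp w h0).1
      rw [h1, hv] at this
      simpa using this.symm
    · have hv0 : 0 < G.dist r v := hG.connected.pos_dist_of_ne (Ne.symm hv)
      have hpv : p v ∈ G.neighborFinset v := by simpa using (hp v hv0).1
      have hle : (Finset.univ.filter (fun w => 0 < G.dist r w ∧ p w = v)).card ≤
          ((G.neighborFinset v).erase (p v)).card := by
        apply Finset.card_le_card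
        intro w hw
        simp only [Finset.mem_filter, Finset.mem_univ, true_and] at hw
        obtain ⟨h0, h1⟩ := hw
        have h2 := hp w h0
        rw [h1] at h2
        rw [Finset.mem_erase]
        refine ⟨?_, by simpa using h2.1.symm⟩
        rintro rfl
        have := (hp v hv0).2
        omega
      rw [Finset.card_erase_of_mem hpv, SimpleGraph.card_neighborFinset_eq_degree] at hle
      have := (G.degree_le_maxDegree v).trans hmax
      omega
  have hdr : ∀ j y, j ≤ G.dist r y → G.dist r (p^[j] y) + j = G.dist r y := by
    intro j
    induction j with
    | zero => intro y _; simp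
    | succ j ih =>
      intro y hy
      have h1 := ih y (by omega)
      rw [Function.iterate_succ_apply']
      have h2 := (hp (p^[j] y) (by omega)).2
      omega
  obtain ⟨z, hz, K, hK, hKp⟩ := core_branch p (G.dist r) (Δ - 1) a (fun w hw => (hp w hw).2) hfib
    (by omega) a le_rfl (Finset.univ.image x) r
    ⟨x ⟨0, hm⟩, Finset.mem_image_of_mem _ (Finset.mem_univ _)⟩
    (fun y hy => by
      obtain ⟨i, _, rfl⟩ := Finset.mem_image.1 hy
      exact hdist i)
    (fun y hy => by
      obtain ⟨i, _, rfl⟩ := Finset.mem_image.1 hy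
      have := hdr a (x i) (hdist i).ge
      rw [hdist i] at this
      exact ((hG.connected.dist_eq_zero_iff).1 (by omega)).symm)
  obtain ⟨i, _, rfl⟩ := Finset.mem_image.1 hz
  refine ⟨i, ?_⟩
  rw [Finset.card_image_of_injective _ hinj, Finset.card_univ, Fintype.card_fin] at hK
  have hlog : Real.logb ((Δ : ℝ) - 1) (m : ℝ) ≤ K.card := by
    have hΔ' : (3 : ℝ) ≤ Δ := by exact_mod_cast hΔ
    have hm' : (0 : ℝ) < m := by exact_mod_cast hm
    rw [Real.logb_le_iff_le_rpow (by linarith) hm', Real.rpow_natCast]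
    have : ((m : ℕ) : ℝ) ≤ (((Δ - 1) ^ K.card : ℕ) : ℝ) := by exact_mod_cast hK
    rw [Nat.cast_pow, Nat.cast_sub (by omega)] at this
    simpa using this
  have hcard : K.card + 1 ≤ ({ L : ℕ | L ≤ 2 * a ∧ ∃ (v : V) (p : G.Walk (x i) v),
            p.IsPath ∧ G.degree v = 1 ∧ p.length = L }).ncard := by
    have h1 : (insert 0 (K.image (fun k => 2 * k))).card = K.card + 1 := by
      rw [Finset.card_insert_of_notMem, Finset.card_image_of_injective]
      · intro b c h
        simpa using h
      · intro h
        obtain ⟨k, hk, hk0⟩ := Finset.mem_image.1 h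
        have := (hKp k hk).1
        simp at hk0
        omega
    rw [← h1, ← Set.ncard_coe_finset]
    apply Set.ncard_le_ncard
    · intro L hL
      rcases Finset.mem_insert.1 (Finset.mem_coe.1 hL) with rfl | hL
      · exact ⟨by omega, x i, SimpleGraph.Walk.nil, by simp, hleaf i, by simp⟩
      · obtain ⟨k, hk, rfl⟩ := Finset.mem_image.1 hL
        obtain ⟨_, h2, y, hy, h3, h4⟩ := hKp k hk
        obtain ⟨i', _, rfl⟩ := Finset.mem_image.1 hy
        obtain ⟨q, hq, hl, _⟩ := updown_path G p (G.dist r) (fun w hw => (hp w hw).2)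
          (fun w hw => (hp w hw).1) k (x i) (x i') (by rw [hdist]; exact h2)
          (by rw [hdist, hdist]) h3 h4
        exact ⟨by simpa using h2, x i', q, hq, hleaf i', hl⟩
    · exact (Set.finite_le_nat (2 * a)).subset (fun L hL => hL.1)
  have : ((K.card + 1 : ℕ) : ℝ) ≤ _ := Nat.cast_le.2 hcard
  push_cast at this
  linarith
end

section
/- For every k ≥ 3 and n ≥ k + 1, every degree k-critical graph on n vertices contains cycles of at least (log₂ n)/(3 + log₂ k) − 2 distinct lengths. -/
/-- A rooted tree given by a parent function and a depth function. -/
structure RTree (V : Type*) where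
  par : V → V
  dep : V → ℕ
  root : V
  dep_root : dep root = 0
  dep_par : ∀ x, x ≠ root → dep (par x) + 1 = dep x

namespace RTree
variable {V : Type*} (T : RTree V)

def anc (t : ℕ) (x : V) : V := T.par^[T.dep x - t] x

lemma eq_root {x : V} (h : T.dep x = 0) : x = T.root := by
  by_contra hx
  have := T.dep_par x hx
  omega

lemma anc_dep (x : V) : T.anc (T.dep x) x = x := by simp [anc]

lemma anc_par {x : V} (hx : x ≠ T.root) {t : ℕ} (ht : t + 1 ≤ T.dep x) :
    T.anc t (T.par x) = T.anc t x := by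
  have h := T.dep_par x hx
  unfold anc
  have : T.dep x - t = (T.dep (T.par x) - t) + 1 := by omega
  rw [this, Function.iterate_succ_apply]

lemma ne_root {x : V} (h : 0 < T.dep x) : x ≠ T.root := by
  rintro rfl
  rw [T.dep_root] at h
  omega

lemma dep_anc {x : V} : ∀ {t : ℕ}, t ≤ T.dep x → T.dep (T.anc t x) = t := by
  induction hd : T.dep x using Nat.strong_induction_on generalizing x with
  | _ d ih =>
    intro t ht
    rcases Nat.eq_or_lt_of_le ht with h | h
    · subst h; rw [← hd, anc_dep]
    · have hx := T.ne_root (x := x) (by omega)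
      have h2 := T.dep_par x hx
      rw [← T.anc_par hx (by omega)]
      exact ih (T.dep (T.par x)) (by omega) rfl (by omega)

lemma anc_anc {x : V} : ∀ {s t : ℕ}, s ≤ t → t ≤ T.dep x → T.anc s (T.anc t x) = T.anc s x := by
  induction hd : T.dep x using Nat.strong_induction_on generalizing x with
  | _ d ih =>
    intro s t hs ht
    rcases Nat.eq_or_lt_of_le ht with h | h
    · subst h; rw [← hd, anc_dep]
    · have hx := T.ne_root (x := x) (by omega)
      have h2 := T.dep_par x hx
      rw [← T.anc_par hx (t := t) (by omega), ← T.anc_par hx (t := s) (by omega)]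
      exact ih (T.dep (T.par x)) (by omega) rfl hs (by omega)

lemma par_anc {x : V} {t : ℕ} (ht : t + 1 ≤ T.dep x) : T.par (T.anc (t+1) x) = T.anc t x := by
  have h1 := T.dep_anc ht
  have h2 := T.ne_root (x := T.anc (t+1) x) (by omega)
  have h3 := T.dep_par _ h2
  rw [← T.anc_anc (Nat.le_succ t) ht, ← T.anc_par h2 (by omega)]
  have : T.dep (T.par (T.anc (t+1) x)) = t := by omega
  have e := T.anc_dep (T.par (T.anc (t+1) x))
  rw [this] at e
  exact e.symm

open Classical in
noncomputable def lam (x y : V) : ℕ :=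
  Nat.findGreatest (fun t => T.anc t x = T.anc t y) (min (T.dep x) (T.dep y))

lemma lam_le_left (x y : V) : T.lam x y ≤ T.dep x := by
  classical
  unfold lam
  exact (Nat.findGreatest_le _).trans (min_le_left _ _)

lemma lam_le_right (x y : V) : T.lam x y ≤ T.dep y := by
  classical
  unfold lam
  exact (Nat.findGreatest_le _).trans (min_le_right _ _)

lemma anc_lam (x y : V) : T.anc (T.lam x y) x = T.anc (T.lam x y) y := by
  classical
  have h0 : T.anc 0 x = T.anc 0 y := by
    rw [T.eq_root (T.dep_anc (x := x) (Nat.zero_le _)), T.eq_root (T.dep_anc (x := y) (Nat.zero_le _))]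
  unfold lam
  exact Nat.findGreatest_spec (P := fun t => T.anc t x = T.anc t y) (Nat.zero_le _) h0

lemma le_lam_iff {x y : V} {t : ℕ} (hx : t ≤ T.dep x) (hy : t ≤ T.dep y) :
    t ≤ T.lam x y ↔ T.anc t x = T.anc t y := by
  classical
  constructor
  · intro h
    rw [← T.anc_anc h (T.lam_le_left x y), ← T.anc_anc h (T.lam_le_right x y), T.anc_lam]
  · intro h
    unfold lam
    exact Nat.le_findGreatest (le_min hx hy) h

lemma lam_comm (x y : V) : T.lam x y = T.lam y x := by
  apply le_antisymm
  · rw [T.le_lam_iff (T.lam_le_right _ _) (T.lam_le_left _ _), T.anc_lam]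
  · rw [T.le_lam_iff (T.lam_le_right _ _) (T.lam_le_left _ _), T.anc_lam]

lemma lam_self (x : V) : T.lam x x = T.dep x :=
  le_antisymm (T.lam_le_left _ _) ((T.le_lam_iff le_rfl le_rfl).2 rfl)

lemma lam_ultra (x y z : V) : min (T.lam x y) (T.lam y z) ≤ T.lam x z := by
  have a := T.lam_le_left x y
  have b := T.lam_le_right x y
  have c := T.lam_le_right y z
  rw [T.le_lam_iff (by omega) (by omega)]
  have h1 := (T.le_lam_iff (t := min (T.lam x y) (T.lam y z)) (x := x) (y := y) (by omega) (by omega)).1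
    (min_le_left _ _)
  have h2 := (T.le_lam_iff (t := min (T.lam x y) (T.lam y z)) (x := y) (y := z) (by omega) (by omega)).1
    (min_le_right _ _)
  rw [h1, h2]

lemma lam_four (x y z w : V) :
    min (T.lam x z + T.lam y w) (T.lam x w + T.lam y z) ≤ T.lam x y + T.lam z w := by
  have h1 := T.lam_ultra x z y
  have h2 := T.lam_ultra x w y
  have h3 := T.lam_ultra z x w
  have h4 := T.lam_ultra z y w
  have h5 := T.lam_ultra x z w
  have h6 := T.lam_ultra x w z
  have h7 := T.lam_ultra y z w
  have h8 := T.lam_ultra y w z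
  have h9 := T.lam_ultra z x y
  have h10 := T.lam_ultra z y x
  have h11 := T.lam_ultra w x y
  have h12 := T.lam_ultra w y x
  rw [T.lam_comm z x, T.lam_comm z y, T.lam_comm w x, T.lam_comm w y, T.lam_comm w z, T.lam_comm y x] at *
  omega

lemma lam_par {x y : V} (hxy : x ≠ y) (hd : T.dep y ≤ T.dep x) :
    x ≠ T.root ∧ T.lam (T.par x) y = T.lam x y := by
  have hx : x ≠ T.root := by
    rintro rfl
    rw [T.dep_root] at hd
    exact hxy (T.eq_root (x := y) (by omega)).symm
  refine ⟨hx, ?_⟩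
  have h1 := T.dep_par x hx
  have hlt : T.lam x y < T.dep x := by
    by_contra h
    have a := T.lam_le_left x y
    have b := T.lam_le_right x y
    have e1 : T.lam x y = T.dep x := by omega
    have e2 : T.lam x y = T.dep y := by omega
    have := T.anc_lam x y
    rw [e1, anc_dep, ← e1, e2, anc_dep] at this
    exact hxy this
  apply le_antisymm
  · have a := T.lam_le_left (T.par x) y
    have b := T.lam_le_right (T.par x) y
    rw [T.le_lam_iff (by omega) b, ← T.anc_par hx (by omega), T.anc_lam]
  · have b := T.lam_le_right x y
    rw [T.le_lam_iff (by omega) b, T.anc_par hx (by omega), T.anc_lam]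

/-- tree paths -/
lemma exists_path (G : SimpleGraph V) (hG : ∀ x, x ≠ T.root → G.Adj x (T.par x)) (x y : V) :
    ∃ p : G.Walk x y, p.IsPath ∧ p.length + 2 * T.lam x y = T.dep x + T.dep y ∧
      ∀ z ∈ p.support, (∃ t ≤ T.dep x, z = T.anc t x) ∨ (∃ t ≤ T.dep y, z = T.anc t y) := by
  induction hn : T.dep x + T.dep y using Nat.strong_induction_on generalizing x y with
  | _ n ih =>
    have key : ∀ x y : V, x ≠ y → T.dep y ≤ T.dep x → T.dep x + T.dep y = n →
        ∃ p : G.Walk x y, p.IsPath ∧ p.length + 2 * T.lam x y = T.dep x + T.dep y ∧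
        ∀ z ∈ p.support, (∃ t ≤ T.dep x, z = T.anc t x) ∨ (∃ t ≤ T.dep y, z = T.anc t y) := by
      intro x y hxy hd hn
      obtain ⟨hx, hl⟩ := T.lam_par hxy hd
      have h1 := T.dep_par x hx
      obtain ⟨p, hp, hlen, hs⟩ := ih (T.dep (T.par x) + T.dep y) (by omega) (T.par x) y rfl
      refine ⟨SimpleGraph.Walk.cons (hG x hx) p, ?_, ?_, ?_⟩
      · rw [SimpleGraph.Walk.cons_isPath_iff]
        refine ⟨hp, fun hmem => ?_⟩
        rcases hs x hmem with ⟨t, ht, he⟩ | ⟨t, ht, he⟩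
        · have := T.dep_anc ht
          rw [← he] at this; omega
        · have h3 := T.dep_anc ht
          rw [← he] at h3
          have : t = T.dep y := by omega
          rw [this, anc_dep] at he
          exact hxy he
      · rw [SimpleGraph.Walk.length_cons]; omega
      · intro z hz
        rw [SimpleGraph.Walk.support_cons, List.mem_cons] at hz
        rcases hz with rfl | hz
        · exact Or.inl ⟨T.dep z, le_rfl, (T.anc_dep z).symm⟩
        · rcases hs z hz with ⟨t, ht, he⟩ | h
          · left; exact ⟨t, by omega, by rw [he, T.anc_par hx (by omega)]⟩
          · exact Or.inr h
    by_cases hxy : x = y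
    · subst hxy
      refine ⟨SimpleGraph.Walk.nil, by simp, by rw [T.lam_self]; simp; omega, ?_⟩
      intro z hz
      simp at hz
      left; exact ⟨T.dep x, le_rfl, by rw [hz, T.anc_dep]⟩
    · rcases le_total (T.dep y) (T.dep x) with h | h
      · have := key x y hxy h hn
        rwa [hn] at this
      · obtain ⟨p, hp, hl, hs⟩ := key y x (Ne.symm hxy) h (by omega)
        refine ⟨p.reverse, hp.reverse, ?_, ?_⟩
        · rw [SimpleGraph.Walk.length_reverse, T.lam_comm]; omega
        · intro z hz
          rw [SimpleGraph.Walk.support_reverse, List.mem_reverse] at hz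
          exact (hs z hz).symm

end RTree

/-- two paths sharing only their ends form a cycle -/
lemma cycle_of_two_paths {V : Type*} {G : SimpleGraph V} {u v : V} (huv : u ≠ v)
    (p : G.Walk u v) (q : G.Walk v u) (hp : p.IsPath) (hq : q.IsPath) (h2 : 2 ≤ p.length)
    (hd : ∀ z ∈ p.support, z ∈ q.support → z = u ∨ z = v) :
    (p.append q).IsCycle ∧ (p.append q).length = p.length + q.length := by
  refine ⟨hp.isCycle_append hq ?_ (Or.inl h2), SimpleGraph.Walk.length_append _ _⟩
  intro z hz hw
  have hp' := hp.support_nodup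
  have hq' := hq.support_nodup
  rw [← SimpleGraph.Walk.cons_tail_support] at hp' hq'
  rcases hd z (List.mem_of_mem_tail hz) (List.mem_of_mem_tail hw) with rfl | rfl
  · exact (List.nodup_cons.1 hp').1 hz
  · exact (List.nodup_cons.1 hq').1 hw

open Finset in
lemma crit_order_aux {V : Type*} [Fintype V] [DecidableEq V] (G : SimpleGraph V)
    [DecidableRel G.Adj] (k : ℕ)
    (hcrit : ∀ S : Finset V, S.Nonempty → S ≠ Finset.univ →
      ∃ v ∈ S, (S.filter fun u => G.Adj v u).card < k) :
    ∀ (m : ℕ) (S : Finset V), S.card = m → S ≠ Finset.univ → ∃ h : V → ℕ, Set.InjOn h S ∧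
      ∀ x ∈ S, h x < m ∧ (S.filter fun y => G.Adj x y ∧ h y < h x).card < k := by
  intro m
  induction m with
  | zero =>
    intro S hS _
    rw [Finset.card_eq_zero] at hS
    subst hS
    exact ⟨fun _ => 0, by simp, by simp⟩
  | succ m ih =>
    intro S hS hne
    obtain ⟨x, hx, hxk⟩ := hcrit S (Finset.card_pos.1 (by omega)) hne
    obtain ⟨h, hinj, hh⟩ := ih (S.erase x) (by rw [Finset.card_erase_of_mem hx]; omega) (by
      intro hu
      have := Finset.mem_univ x
      rw [← hu] at this
      simp at this)
    have hu : ∀ y, y ≠ x → Function.update h x m y = h y := fun y hy => by simp [hy]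
    refine ⟨Function.update h x m, ?_, ?_⟩
    · intro a ha b hb hab
      by_cases hax : a = x <;> by_cases hbx : b = x
      · rw [hax, hbx]
      · rw [hax, hu b hbx] at hab
        have := (hh b (Finset.mem_erase.2 ⟨hbx, hb⟩)).1
        simp at hab; omega
      · rw [hbx, hu a hax] at hab
        have := (hh a (Finset.mem_erase.2 ⟨hax, ha⟩)).1
        simp at hab; omega
      · rw [hu a hax, hu b hbx] at hab
        exact hinj (by simp [hax]; exact ha) (by simp [hbx]; exact hb) hab
    · intro y hy
      by_cases hyx : y = x
      · subst hyx
        refine ⟨by simp, lt_of_le_of_lt (Finset.card_le_card ?_) hxk⟩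
        intro z hz
        simp only [Finset.mem_filter] at hz ⊢
        exact ⟨hz.1, hz.2.1⟩
      · obtain ⟨h1, h2⟩ := hh y (Finset.mem_erase.2 ⟨hyx, hy⟩)
        refine ⟨by rw [hu y hyx]; omega, lt_of_le_of_lt (Finset.card_le_card ?_) h2⟩
        intro z hz
        simp only [Finset.mem_filter, Finset.mem_erase] at hz ⊢
        rw [hu y hyx] at hz
        by_cases hzx : z = x
        · subst hzx; simp at hz; omega
        · rw [hu z hzx] at hz
          exact ⟨⟨hzx, hz.1⟩, hz.2⟩

open Finset in
lemma crit_order {V : Type*} [Fintype V] [DecidableEq V] (G : SimpleGraph V)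
    [DecidableRel G.Adj] (k : ℕ)
    (hcrit : ∀ S : Finset V, S.Nonempty → S ≠ Finset.univ →
      ∃ v ∈ S, (S.filter fun u => G.Adj v u).card < k) (u : V) :
    ∃ h : V → ℕ, Function.Injective h ∧ (∀ x, h x < Fintype.card V) ∧
      h u + 1 = Fintype.card V ∧
      ∀ x, x ≠ u → (univ.filter fun y => G.Adj x y ∧ h y < h x).card < k := by
  have hpos : 0 < Fintype.card V := Fintype.card_pos_iff.2 ⟨u⟩
  obtain ⟨h, hinj, hh⟩ := crit_order_aux G k hcrit (Fintype.card V - 1) (univ.erase u)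
    (by rw [Finset.card_erase_of_mem (Finset.mem_univ _), Finset.card_univ]) (by
      intro hu
      have := Finset.mem_univ u
      rw [← hu] at this
      simp at this)
  have hu : ∀ y, y ≠ u → Function.update h u (Fintype.card V - 1) y = h y :=
    fun y hy => by simp [hy]
  have hlt : ∀ y, y ≠ u → h y < Fintype.card V - 1 := fun y hy => (hh y (by simp [hy])).1
  refine ⟨Function.update h u (Fintype.card V - 1), ?_, ?_, ?_, ?_⟩
  · intro a b hab
    by_cases hax : a = u <;> by_cases hbx : b = u
    · rw [hax, hbx]
    · rw [hax, hu b hbx] at hab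
      have := hlt b hbx
      simp at hab; omega
    · rw [hbx, hu a hax] at hab
      have := hlt a hax
      simp at hab; omega
    · rw [hu a hax, hu b hbx] at hab
      exact hinj (by simp [hax]) (by simp [hbx]) hab
  · intro x
    by_cases hx : x = u
    · subst hx; simp; omega
    · rw [hu x hx]; have := hlt x hx; omega
  · simp; omega
  · intro x hx
    refine lt_of_le_of_lt (Finset.card_le_card ?_) (hh x (by simp [hx])).2
    intro z hz
    simp only [Finset.mem_filter, Finset.mem_erase, Finset.mem_univ, true_and, and_true] at hz ⊢
    rw [hu x hx] at hz
    by_cases hzx : z = u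
    · subst hzx; have := hlt x hx; simp at hz; omega
    · rw [hu z hzx] at hz
      exact ⟨hzx, hz⟩

lemma sum_min_aux (c : ℕ) : ∀ m, c ≤ m →
    ∑ j ∈ Finset.range m, min c j + (c + 1).choose 2 = c * m := by
  intro m hm
  induction m, hm using Nat.le_induction with
  | base =>
    have : ∑ j ∈ Finset.range c, min c j = ∑ j ∈ Finset.range c, j :=
      Finset.sum_congr rfl fun j hj => by
        have := Finset.mem_range.1 hj
        omega
    rw [this]
    have h1 := Finset.sum_range_id_mul_two (c + 1)
    rw [Finset.sum_range_succ] at h1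
    have h2 := Finset.sum_range_id_mul_two (c + 1)
    rw [Nat.choose_two_right, ← h2, Nat.mul_div_cancel _ (by norm_num)]
    rw [Finset.sum_range_succ] at *
    simp only [Nat.add_sub_cancel] at *
    nlinarith
  | succ m hm ih =>
    rw [Finset.sum_range_succ, min_eq_left hm, mul_add]
    omega

open Finset in
lemma sum_out_eq {V : Type*} [Fintype V] [DecidableEq V] (G : SimpleGraph V)
    [DecidableRel G.Adj] (h : V → ℕ) (hinj : Function.Injective h) :
    ∑ x, (univ.filter fun y => G.Adj x y ∧ h y < h x).card = G.edgeFinset.card := by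
  have h1 := G.sum_degrees_eq_twice_card_edges
  have h2 : ∀ x, G.degree x = (univ.filter fun y => G.Adj x y ∧ h y < h x).card +
      (univ.filter fun y => G.Adj x y ∧ h x < h y).card := by
    intro x
    rw [← Finset.card_union_of_disjoint, ← SimpleGraph.card_neighborFinset_eq_degree]
    · congr 1
      ext y
      simp only [SimpleGraph.mem_neighborFinset, mem_union, mem_filter, mem_univ, true_and]
      constructor
      · intro hxy
        rcases lt_trichotomy (h x) (h y) with hl | hl | hl
        · exact Or.inr ⟨hxy, hl⟩
        · exact absurd (hinj hl) hxy.ne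
        · exact Or.inl ⟨hxy, hl⟩
      · tauto
    · rw [Finset.disjoint_left]
      intro y hy hy'
      simp at hy hy'
      omega
  have h3 : ∑ x, (univ.filter fun y => G.Adj x y ∧ h y < h x).card =
      ∑ x, (univ.filter fun y => G.Adj x y ∧ h x < h y).card := by
    have := Finset.sum_card_bipartiteAbove_eq_sum_card_bipartiteBelow (s := (univ : Finset V))
      (t := (univ : Finset V)) (fun x y => G.Adj x y ∧ h y < h x)
    unfold Finset.bipartiteAbove Finset.bipartiteBelow at this
    rw [this]
    refine Finset.sum_congr rfl fun x _ => ?_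
    congr 1
    ext y
    simp [G.adj_comm]
  simp_rw [h2] at h1
  rw [Finset.sum_add_distrib] at h1
  omega

open Finset in
lemma out_le {V : Type*} [Fintype V] [DecidableEq V] (G : SimpleGraph V)
    [DecidableRel G.Adj] (h : V → ℕ) (hinj : Function.Injective h) (x : V) :
    (univ.filter fun y => G.Adj x y ∧ h y < h x).card ≤ h x := by
  have : ((univ.filter fun y => G.Adj x y ∧ h y < h x).image h).card ≤ (range (h x)).card := by
    apply Finset.card_le_card
    intro j hj
    simp at hj ⊢
    obtain ⟨y, hy, rfl⟩ := hj
    exact hy.2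
  rwa [Finset.card_image_of_injective _ hinj, card_range] at this

open Finset in
lemma sum_h {V : Type*} [Fintype V] [DecidableEq V] (h : V → ℕ) (hinj : Function.Injective h)
    (hlt : ∀ x, h x < Fintype.card V) (f : ℕ → ℕ) :
    ∑ x, f (h x) = ∑ j ∈ range (Fintype.card V), f j := by
  have : (univ : Finset V).image h = range (Fintype.card V) := by
    apply Finset.eq_of_subset_of_card_le
    · intro j hj
      simp at hj ⊢
      obtain ⟨y, rfl⟩ := hj
      exact hlt y
    · rw [Finset.card_image_of_injective _ hinj]; simp
  rw [← this, Finset.sum_image (fun a _ b _ hab => hinj hab)]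

open Finset in
lemma crit_good_order {V : Type*} [Fintype V] [DecidableEq V] (G : SimpleGraph V)
    [DecidableRel G.Adj] (k : ℕ) (hk : 3 ≤ k) (hn : k + 1 ≤ Fintype.card V)
    (hedges : G.edgeFinset.card + k.choose 2 = (k - 1) * Fintype.card V + 1)
    (hcrit : ∀ S : Finset V, S.Nonempty → S ≠ Finset.univ →
      ∃ v ∈ S, (S.filter fun u => G.Adj v u).card < k) :
    ∃ (h : V → ℕ) (v : V), Function.Injective h ∧ (∀ x, h x ≤ h v) ∧
      (∀ x, (univ.filter fun y => G.Adj x y ∧ h y < h x).card ≤ k) ∧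
      (∀ x, x ≠ v → ∃ y, G.Adj x y ∧ h x < h y) ∧
      (∀ x, min 2 (h x) ≤ (univ.filter fun y => G.Adj x y ∧ h y < h x).card) := by
  have hsum := sum_min_aux (k - 1) (Fintype.card V) (by omega)
  rw [Nat.sub_add_cancel (by omega : 1 ≤ k)] at hsum
  have hout_deg : ∀ (h : V → ℕ) x,
      (univ.filter fun y => G.Adj x y ∧ h y < h x).card ≤ G.degree x := by
    intro h x
    rw [← SimpleGraph.card_neighborFinset_eq_degree]
    apply Finset.card_le_card
    intro y hy
    simp at hy ⊢
    exact hy.1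
  have hdeg : ∀ u, k ≤ G.degree u := by
    intro u
    by_contra hu
    push Not at hu
    obtain ⟨h, hinj, hlt, hu1, hout⟩ := crit_order G k hcrit u
    have h1 := sum_out_eq G h hinj
    have h2 := sum_h h hinj hlt (fun j => min (k - 1) j)
    have h3 : ∑ x, (univ.filter fun y => G.Adj x y ∧ h y < h x).card ≤
        ∑ x, min (k - 1) (h x) := by
      refine Finset.sum_le_sum fun x _ => ?_
      have a := out_le G h hinj x
      have b := hout_deg h x
      by_cases hx : x = u
      · subst hx; omega
      · have := hout x hx; omega
    omega
  have hex : ∃ w : V, True := by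
    obtain ⟨w⟩ := Fintype.card_pos_iff.1 (by omega : 0 < Fintype.card V)
    exact ⟨w, trivial⟩
  obtain ⟨w, -⟩ := hex
  obtain ⟨v, -, hv⟩ := hcrit (univ.erase w) (by
    rw [← Finset.card_pos, Finset.card_erase_of_mem (mem_univ _), Finset.card_univ]; omega) (by
      intro hu
      have := Finset.mem_univ w
      rw [← hu] at this
      simp at this)
  have hvk : G.degree v ≤ k := by
    rw [← SimpleGraph.card_neighborFinset_eq_degree]
    have : G.neighborFinset v ⊆ insert w ((univ.erase w).filter fun u => G.Adj v u) := by
      intro y hy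
      simp at hy ⊢
      tauto
    have h1 := Finset.card_le_card this
    have h2 := Finset.card_insert_le w ((univ.erase w).filter fun u => G.Adj v u)
    omega
  obtain ⟨h, hinj, hlt, hu1, hout⟩ := crit_order G k hcrit v
  have h1 := sum_out_eq G h hinj
  have h2 := sum_h h hinj hlt (fun j => min (k - 1) j)
  have h4 : ∀ x ∈ univ.erase v, (univ.filter fun y => G.Adj x y ∧ h y < h x).card ≤
      min (k - 1) (h x) := by
    intro x hx
    have a := out_le G h hinj x
    have := hout x (Finset.ne_of_mem_erase hx)
    omega
  have hov := hout_deg h v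
  have h5 : ∀ x ∈ univ.erase v, (univ.filter fun y => G.Adj x y ∧ h y < h x).card =
      min (k - 1) (h x) := by
    rw [← Finset.sum_eq_sum_iff_of_le h4]
    apply le_antisymm (Finset.sum_le_sum h4)
    rw [← Finset.add_sum_erase _ _ (mem_univ v)] at h1 h2
    omega
  have hmax : ∀ x, h x ≤ h v := fun x => by have := hlt x; omega
  have hfull : (univ.filter fun y => G.Adj v y ∧ h y < h v).card = G.degree v := by
    rw [← SimpleGraph.card_neighborFinset_eq_degree]
    congr 1
    ext y
    simp only [mem_filter, mem_univ, true_and, SimpleGraph.mem_neighborFinset,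
      and_iff_left_iff_imp]
    intro hy
    exact lt_of_le_of_ne (hmax y) fun he => hy.ne (hinj he).symm
  refine ⟨h, v, hinj, hmax, ?_, ?_, ?_⟩
  · intro x
    by_cases hx : x = v
    · subst hx; omega
    · have := h4 x (by simp [hx]); omega
  · intro x hx
    by_contra hcon
    push Not at hcon
    have a := h4 x (by simp [hx])
    have b : G.neighborFinset x ⊆ (univ.filter fun y => G.Adj x y ∧ h y < h x) := by
      intro y hy
      simp at hy ⊢
      exact ⟨hy, lt_of_le_of_ne (hcon y hy) fun he => hy.ne (hinj he).symm⟩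
    have c := Finset.card_le_card b
    rw [SimpleGraph.card_neighborFinset_eq_degree] at c
    have := hdeg x
    omega
  · intro x
    by_cases hx : x = v
    · subst hx; have := hdeg x; omega
    · have := h5 x (by simp [hx]); omega

lemma exists_potential {V : Type*} [Fintype V] (E : V → V → Prop) (g0 : V → ℕ)
    (h0 : ∀ x y, E x y → g0 x < g0 y) :
    ∃ g : V → ℕ, (∀ x y, E x y → g x < g y) ∧ ∀ y, g y = 0 ∨ ∃ x, E x y ∧ g x + 1 = g y := by
  classical
  have hex : ∃ m, ∃ g : V → ℕ, (∀ x y, E x y → g x < g y) ∧ ∑ x, g x = m := ⟨_, g0, h0, rfl⟩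
  obtain ⟨g, hg, hm⟩ := Nat.find_spec hex
  refine ⟨g, hg, fun y => ?_⟩
  by_contra hcon
  push Not at hcon
  obtain ⟨hy, hc⟩ := hcon
  refine Nat.find_min hex (m := ∑ x, Function.update g y (g y - 1) x) ?_
    ⟨Function.update g y (g y - 1), ?_, rfl⟩
  · rw [← hm]
    refine Finset.sum_lt_sum (fun x _ => ?_) ⟨y, Finset.mem_univ _, ?_⟩
    · by_cases hx : x = y
      · subst hx; simp
      · simp [hx]
    · simp; omega
  · intro a b hab
    have h1 := hg a b hab
    have hne : a ≠ b := by rintro rfl; omega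
    by_cases ha : a = y
    · subst ha
      rw [Function.update_self, Function.update_of_ne hne.symm]; omega
    · by_cases hb : b = y
      · subst hb
        rw [Function.update_self, Function.update_of_ne hne]
        have := hc a hab
        omega
      · rw [Function.update_of_ne ha, Function.update_of_ne hb]; exact h1

/-- The layered structure extracted from a degree-critical graph. -/
structure Lay {V : Type*} (G : SimpleGraph V) (k : ℕ) where
  h : V → ℕ
  hinj : Function.Injective h
  A : RTree V
  B : RTree V
  A_edge : ∀ x, x ≠ A.root → G.Adj x (A.par x) ∧ h x < h (A.par x)
  B_edge : ∀ x, x ≠ B.root → G.Adj x (B.par x) ∧ h (B.par x) < h x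
  A_lt : ∀ x y, G.Adj x y → h y < h x → A.dep x < A.dep y
  two : ∀ x, 2 ≤ h x → ∀ z, ∃ y, G.Adj x y ∧ h y < h x ∧ y ≠ z
  outk : ∀ x, ∃ S : Finset V, S.card ≤ k ∧ ∀ y, G.Adj x y → h y < h x → y ∈ S
  hB : h B.root = 0

/-- The set of cycle lengths. -/
def cycLens {V : Type*} (G : SimpleGraph V) : Set ℕ :=
  { L : ℕ | ∃ (v : V) (p : G.Walk v v), p.IsCycle ∧ p.length = L }

lemma cycLens_finite {V : Type*} [Fintype V] (G : SimpleGraph V) : (cycLens G).Finite := by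
  apply (Set.finite_Iic (Fintype.card V)).subset
  rintro L ⟨v, p, hp, rfl⟩
  have := hp.support_nodup.length_le_card
  simp at this
  simpa using this

namespace Lay
variable {V : Type*} {G : SimpleGraph V} {k : ℕ} (T : Lay G k)

/-- The spine. -/
def sp (j : ℕ) : V := T.A.anc j T.B.root

/-- The number of layers. -/
def ell : ℕ := T.A.dep T.B.root

lemma sp_ell : T.sp T.ell = T.B.root := T.A.anc_dep _

lemma dep_sp {j : ℕ} (hj : j ≤ T.ell) : T.A.dep (T.sp j) = j := T.A.dep_anc hj

lemma sp_succ {j : ℕ} (hj : j + 1 ≤ T.ell) :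
    G.Adj (T.sp j) (T.sp (j+1)) ∧ T.h (T.sp (j+1)) < T.h (T.sp j) := by
  have h1 : T.A.par (T.sp (j+1)) = T.sp j := T.A.par_anc hj
  have h2 := T.A_edge (T.sp (j+1)) (T.A.ne_root (by rw [T.dep_sp hj]; omega))
  rw [h1] at h2
  exact ⟨h2.1.symm, h2.2⟩

lemma eq_sink {x : V} (hx : T.h x = 0) : x = T.B.root := T.hinj (by rw [hx, T.hB])

lemma dep_le (x : V) : T.A.dep x ≤ T.ell := by
  induction hh : T.h x using Nat.strong_induction_on generalizing x with
  | _ m ih =>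
    by_cases hx : x = T.B.root
    · rw [hx]; exact le_rfl
    · obtain ⟨h1, h2⟩ := T.B_edge x hx
      have := T.A_lt _ _ h1 h2
      have := ih _ (by omega) (T.B.par x) rfl
      omega

lemma scale_path (y y' : V) (hne : y ≠ y') :
    ∃ p : G.Walk y y', p.IsPath ∧ (∀ z ∈ p.support, T.h z ≤ max (T.h y) (T.h y')) ∧
      p.length + T.A.dep y + T.A.dep y' ≤ 2 * T.ell ∧
      ∀ j ≤ T.ell, (T.sp j = y ∨ T.sp j = y') → ∀ j', j ≤ j' → j' ≤ T.ell →
        T.sp j' ∈ p.support := by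
  induction hm : T.h y + T.h y' using Nat.strong_induction_on generalizing y y' with
  | _ m ih =>
    have key : ∀ y y' : V, T.h y' < T.h y → T.h y + T.h y' = m →
        ∃ p : G.Walk y y', p.IsPath ∧ (∀ z ∈ p.support, T.h z ≤ max (T.h y) (T.h y')) ∧
      p.length + T.A.dep y + T.A.dep y' ≤ 2 * T.ell ∧
      ∀ j ≤ T.ell, (T.sp j = y ∨ T.sp j = y') → ∀ j', j ≤ j' → j' ≤ T.ell →
        T.sp j' ∈ p.support := by
      clear hne hm y y'
      intro y y' hlt hm
      have hyroot : y ≠ T.B.root := by rintro rfl; rw [T.hB] at hlt; omega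
      by_cases h1 : T.h y = 1
      · have hy' : y' = T.B.root := T.eq_sink (by omega)
        obtain ⟨ha, hb⟩ := T.B_edge y hyroot
        have hp : T.B.par y = y' := by rw [hy']; exact T.eq_sink (by omega)
        rw [hp] at ha hb
        have hd := T.A_lt _ _ ha hb
        have hd2 := T.dep_le y'
        refine ⟨SimpleGraph.Walk.cons ha SimpleGraph.Walk.nil, ?_, ?_, ?_, ?_⟩
        · simp [ha.ne]
        · intro z hz
          simp at hz
          rcases hz with rfl | rfl <;> simp
        · simp; omega
        · intro j hj hor j' hj' hj2
          simp only [SimpleGraph.Walk.support_cons, SimpleGraph.Walk.support_nil, List.mem_cons,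
            List.not_mem_nil, or_false]
          rcases hor with hor | hor
          · rcases Nat.eq_or_lt_of_le hj' with rfl | hlt'
            · exact Or.inl hor
            · right
              have hs := T.sp_succ (j := j) (by omega)
              have h3 : T.sp (j+1) = T.B.root := T.eq_sink (by rw [hor] at hs; omega)
              have h4 := T.dep_sp (j := j+1) (by omega)
              rw [h3] at h4
              have : j' = j + 1 := by unfold ell at hj2; omega
              rw [this, h3, hy']
          · right
            have h4 := T.dep_sp hj
            rw [hor, hy'] at h4
            have : j' = j := by unfold ell at hj2; omega
            rw [this, hor]
      · have hch : ∃ w, G.Adj y w ∧ T.h w < T.h y ∧ w ≠ y' ∧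
            ∀ j ≤ T.ell, T.sp j = y → j + 1 ≤ T.ell → T.sp (j+1) = w ∨ T.sp (j+1) = y' := by
          by_cases hc : ∃ j, j + 1 ≤ T.ell ∧ T.sp j = y ∧ T.sp (j+1) ≠ y'
          · obtain ⟨j, hj, hjy, hjy'⟩ := hc
            have hs := T.sp_succ hj
            rw [hjy] at hs
            refine ⟨T.sp (j+1), hs.1, hs.2, hjy', ?_⟩
            intro i hi hiy _
            left
            have e1 := T.dep_sp hi
            have e2 := T.dep_sp (j := j) (by omega)
            rw [hiy] at e1
            rw [hjy] at e2
            have : i = j := by omega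
            rw [this]
          · push Not at hc
            obtain ⟨w, hw1, hw2, hw3⟩ := T.two y (by omega) y'
            exact ⟨w, hw1, hw2, hw3, fun j _ hjy hj1 => Or.inr (hc j hj1 hjy)⟩
        obtain ⟨w, hw1, hw2, hw3, hw4⟩ := hch
        obtain ⟨p, hp, hs, hl, ht⟩ := ih (T.h w + T.h y') (by omega) w y' hw3 rfl
        refine ⟨SimpleGraph.Walk.cons hw1 p, ?_, ?_, ?_, ?_⟩
        · rw [SimpleGraph.Walk.cons_isPath_iff]
          refine ⟨hp, fun hmem => ?_⟩
          have := hs _ hmem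
          omega
        · intro z hz
          rw [SimpleGraph.Walk.support_cons, List.mem_cons] at hz
          rcases hz with rfl | hz
          · simp
          · have := hs z hz; omega
        · have := T.A_lt _ _ hw1 hw2
          rw [SimpleGraph.Walk.length_cons]; omega
        · intro j hj hor j' hj' hj2
          rw [SimpleGraph.Walk.support_cons, List.mem_cons]
          rcases hor with hor | hor
          · rcases Nat.eq_or_lt_of_le hj' with rfl | hlt'
            · exact Or.inl hor
            · right
              exact ht (j+1) (by omega) (hw4 j hj hor (by omega)) j' (by omega) hj2
          · exact Or.inr (ht j hj (Or.inr hor) j' hj' hj2)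
    rcases lt_trichotomy (T.h y') (T.h y) with h | h | h
    · exact key y y' h hm
    · exact absurd (T.hinj h).symm hne
    · obtain ⟨p, hp, hs, hl, ht⟩ := key y' y h (by omega)
      refine ⟨p.reverse, hp.reverse, ?_, ?_, ?_⟩
      · intro z hz
        rw [SimpleGraph.Walk.support_reverse, List.mem_reverse] at hz
        have := hs z hz
        omega
      · rw [SimpleGraph.Walk.length_reverse]; omega
      · intro j hj hor j' hj' hj2
        rw [SimpleGraph.Walk.support_reverse, List.mem_reverse]
        exact ht j hj hor.symm j' hj' hj2

lemma scale_cycle (s : ℕ) (hs : 2 ≤ s) (hs2 : s ≤ T.ell) :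
    ∃ L ∈ cycLens G, s + 1 ≤ L ∧ L ≤ 2 * s := by
  classical
  obtain ⟨t, ht⟩ : ∃ t, t + s = T.ell := ⟨T.ell - s, by omega⟩
  have e1 := T.sp_succ (j := t) (by omega)
  have e2 := T.sp_succ (j := t+1) (by omega)
  obtain ⟨y, hy1, hy2, hy3⟩ := T.two (T.sp t) (by omega) (T.sp (t+1))
  obtain ⟨p, hp, hsup, hl, htr⟩ := T.scale_path (T.sp (t+1)) y hy3.symm
  have hd := T.A_lt _ _ hy1 hy2
  have hd1 := T.dep_sp (j := t) (by omega)
  have hd2 := T.dep_sp (j := t+1) (by omega)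
  have hnot : T.sp t ∉ p.support := by
    intro hmem
    have := hsup _ hmem
    omega
  have hp' : (SimpleGraph.Walk.cons e1.1 p).IsPath := by
    rw [SimpleGraph.Walk.cons_isPath_iff]; exact ⟨hp, hnot⟩
  have hpos : 1 ≤ p.length := by
    by_contra hc
    exact hy3 (SimpleGraph.Walk.eq_of_length_eq_zero (p := p) (by omega)).symm
  have hcyc := cycle_of_two_paths hy1.ne (SimpleGraph.Walk.cons e1.1 p)
    (SimpleGraph.Walk.cons hy1.symm SimpleGraph.Walk.nil) hp' (by simp [hy1.ne.symm])
    (by rw [SimpleGraph.Walk.length_cons]; omega) (by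
      intro z _ hz
      simp at hz
      tauto)
  refine ⟨_, ⟨_, _, hcyc.1, hcyc.2⟩, ?_, ?_⟩
  · have hsub : (Finset.Icc (t+1) T.ell).image T.sp ⊆ p.support.toFinset := by
      intro z hz
      rw [Finset.mem_image] at hz
      obtain ⟨j, hj, rfl⟩ := hz
      rw [Finset.mem_Icc] at hj
      rw [List.mem_toFinset]
      exact htr (t+1) (by omega) (Or.inl rfl) j hj.1 hj.2
    have hc := Finset.card_le_card hsub
    rw [Finset.card_image_of_injOn, Nat.card_Icc] at hc
    · have := List.toFinset_card_le p.support
      rw [SimpleGraph.Walk.length_support] at this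
      simp only [SimpleGraph.Walk.length_cons, SimpleGraph.Walk.length_nil]
      omega
    · intro a ha b hb hab
      simp only [Finset.coe_Icc, Set.mem_Icc] at ha hb
      rw [← T.dep_sp ha.2, ← T.dep_sp hb.2, hab]
  · simp only [SimpleGraph.Walk.length_cons, SimpleGraph.Walk.length_nil]
    omega

lemma ell_lt [Fintype V] : T.ell < 2 ^ ((cycLens G).ncard + 1) := by
  by_contra hcon
  push Not at hcon
  have : ∀ j : ℕ, ∃ L, j ∈ Finset.Icc 1 ((cycLens G).ncard + 1) →
      L ∈ cycLens G ∧ 2 ^ j + 1 ≤ L ∧ L ≤ 2 * 2 ^ j := by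
    intro j
    by_cases hj : j ∈ Finset.Icc 1 ((cycLens G).ncard + 1)
    · rw [Finset.mem_Icc] at hj
      obtain ⟨L, h1, h2⟩ := T.scale_cycle (2 ^ j)
        (by calc 2 = 2 ^ 1 := rfl
              _ ≤ 2 ^ j := Nat.pow_le_pow_right (by norm_num) hj.1)
        ((Nat.pow_le_pow_right (by norm_num) hj.2).trans hcon)
      exact ⟨L, fun _ => ⟨h1, h2⟩⟩
    · exact ⟨0, fun h => absurd h hj⟩
  choose L hL using this
  have hc := Set.ncard_le_ncard (s := ((Finset.Icc 1 ((cycLens G).ncard + 1)).image L : Finset ℕ))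
    (t := cycLens G) (by
      intro z hz
      simp only [Finset.coe_image, Set.mem_image, Finset.mem_coe] at hz
      obtain ⟨j, hj, rfl⟩ := hz
      exact (hL j hj).1) (cycLens_finite G)
  rw [Set.ncard_coe_finset, Finset.card_image_of_injOn, Nat.card_Icc] at hc
  · omega
  · have aux : ∀ a b, a ∈ Finset.Icc 1 ((cycLens G).ncard + 1) →
        b ∈ Finset.Icc 1 ((cycLens G).ncard + 1) → a < b → L a ≠ L b := by
      intro a b ha hb hab he
      have h1 := hL a ha
      have h2 := hL b hb
      have h3 : 2 ^ (a + 1) ≤ 2 ^ b := Nat.pow_le_pow_right (by norm_num) hab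
      rw [pow_succ] at h3
      omega
    intro a ha b hb hab
    rcases lt_trichotomy a b with h | h | h
    · exact absurd hab (aux a b ha hb h)
    · exact h
    · exact absurd hab.symm (aux b a hb ha h)

end Lay

namespace Lay
variable {V : Type*} {G : SimpleGraph V} {k : ℕ} (T : Lay G k)

lemma B_anc_dep {w : V} : ∀ {t : ℕ}, t ≤ T.B.dep w →
    T.B.anc t w = w ∨ T.A.dep w < T.A.dep (T.B.anc t w) := by
  induction hd : T.B.dep w using Nat.strong_induction_on generalizing w with
  | _ d ih =>
    intro t ht
    rcases Nat.eq_or_lt_of_le ht with h | h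
    · left; rw [h, ← hd, T.B.anc_dep]
    · right
      have hx := T.B.ne_root (x := w) (by omega)
      have h2 := T.B.dep_par w hx
      obtain ⟨h3, h4⟩ := T.B_edge w hx
      have h5 := T.A_lt _ _ h3 h4
      rw [← T.B.anc_par hx (t := t) (by omega)]
      rcases ih (T.B.dep (T.B.par w)) (by omega) rfl (t := t) (by omega) with h | h
      · rw [h]; exact h5
      · omega

/-- length of the cycle through two vertices of one layer -/
noncomputable def D (i : ℕ) (x y : V) : ℕ :=
  2 * i + T.B.dep x + T.B.dep y - 2 * T.A.lam x y - 2 * T.B.lam x y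

lemma D_add {i : ℕ} {x y : V} (hx : T.A.dep x = i) :
    T.D i x y + 2 * T.A.lam x y + 2 * T.B.lam x y = 2 * i + T.B.dep x + T.B.dep y := by
  have h1 := T.A.lam_le_left x y
  have h2 := T.B.lam_le_left x y
  have h3 := T.B.lam_le_right x y
  unfold D
  omega

lemma lam_lt {i : ℕ} {x y : V} (hx : T.A.dep x = i) (hy : T.A.dep y = i) (hne : x ≠ y) :
    T.A.lam x y < i := by
  have h1 := T.A.lam_le_left x y
  by_contra hc
  have e : T.A.lam x y = i := by omega
  have h2 := T.A.anc_lam x y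
  rw [e] at h2
  have h3 := T.A.anc_dep x
  have h4 := T.A.anc_dep y
  rw [hx] at h3
  rw [hy] at h4
  exact hne (by rw [← h3, h2, h4])

lemma layer_cycle {i : ℕ} {x y : V} (hx : T.A.dep x = i) (hy : T.A.dep y = i) (hne : x ≠ y) :
    T.D i x y ∈ cycLens G := by
  obtain ⟨p, hp, hlp, hsp⟩ := T.A.exists_path G (fun z hz => (T.A_edge z hz).1) x y
  obtain ⟨q, hq, hlq, hsq⟩ := T.B.exists_path G (fun z hz => (T.B_edge z hz).1) y x
  have hlt := T.lam_lt hx hy hne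
  have hcyc := cycle_of_two_paths hne p q hp hq (by omega) (by
    intro z hz1 hz2
    have hle : T.A.dep z ≤ i := by
      rcases hsp z hz1 with ⟨t, ht, rfl⟩ | ⟨t, ht, rfl⟩
      · rw [T.A.dep_anc ht]; omega
      · rw [T.A.dep_anc ht]; omega
    rcases hsq z hz2 with ⟨t, ht, rfl⟩ | ⟨t, ht, rfl⟩
    · rcases T.B_anc_dep ht with h | h
      · exact Or.inr h
      · omega
    · rcases T.B_anc_dep ht with h | h
      · exact Or.inl h
      · omega)
  refine ⟨_, _, hcyc.1, ?_⟩
  rw [hcyc.2]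
  have := T.D_add (y := y) hx
  rw [T.B.lam_comm] at hlq
  omega

set_option maxHeartbeats 1000000 in
open Finset in
lemma layer_bound [DecidableEq V] (i : ℕ) : ∀ (m : ℕ) (W : Finset V), (∀ x ∈ W, T.A.dep x = i) →
    (W.offDiag.image fun e => T.D i e.1 e.2).card ≤ m → W.card ≤ (k + 1) ^ m := by
  have hempty : ∀ W : Finset V, (W.offDiag.image fun e => T.D i e.1 e.2) = ∅ → W.card ≤ 1 := by
    intro W hW
    rw [Finset.image_eq_empty] at hW
    rw [Finset.card_le_one]
    intro a ha b hb
    by_contra hab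
    have : (a, b) ∈ W.offDiag := Finset.mem_offDiag.2 ⟨ha, hb, hab⟩
    rw [hW] at this
    simp at this
  intro m
  induction m with
  | zero =>
    intro W _ hc
    have := hempty W (Finset.card_eq_zero.1 (by omega))
    simpa using this
  | succ m ih =>
    intro W hW hc
    by_cases he : (W.offDiag.image fun e => T.D i e.1 e.2) = ∅
    · exact (hempty W he).trans (Nat.one_le_pow (m + 1) (k + 1) (Nat.succ_pos k))
    · rw [Finset.image_eq_empty] at he
      obtain ⟨e1, he1, hmaxD⟩ := Finset.exists_max_image W.offDiag (fun e => T.D i e.1 e.2)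
        (Finset.nonempty_iff_ne_empty.2 he)
      obtain ⟨M, hM⟩ : ∃ M : ℕ, T.D i e1.1 e1.2 = M := ⟨_, rfl⟩
      rw [hM] at hmaxD
      have hMmem : M ∈ (W.offDiag.image fun e => T.D i e.1 e.2) :=
        Finset.mem_image.2 ⟨e1, he1, hM⟩
      have hle : ∀ a ∈ W, ∀ b ∈ W, a ≠ b → T.D i a b ≤ M := by
        intro a ha b hb hab
        exact hmaxD (a, b) (Finset.mem_offDiag.2 ⟨ha, hb, hab⟩)
      have hPne : (W.offDiag.filter fun e => T.D i e.1 e.2 = M).Nonempty := by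
        rw [Finset.mem_image] at hMmem
        obtain ⟨e, he1, he2⟩ := hMmem
        exact ⟨e, Finset.mem_filter.2 ⟨he1, he2⟩⟩
      obtain ⟨⟨x0, y0⟩, h0, hmax⟩ := Finset.exists_max_image _ (fun e => T.A.lam e.1 e.2) hPne
      simp only [Finset.mem_filter, Finset.mem_offDiag] at h0 hmax
      obtain ⟨⟨hx0, hy0, hxy0⟩, hD0⟩ := h0
      have hdx0 := hW x0 hx0
      have hdy0 := hW y0 hy0
      have hmax' : ∀ a ∈ W, ∀ b ∈ W, a ≠ b → T.D i a b = M →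
          T.A.lam a b ≤ T.A.lam x0 y0 :=
        fun a ha b hb hab hd => hmax (a, b) ⟨⟨ha, hb, hab⟩, hd⟩
      have ht0 := T.lam_lt hdx0 hdy0 hxy0
      obtain ⟨t0, ht⟩ : ∃ t0, t0 = T.A.lam x0 y0 := ⟨_, rfl⟩
      rw [← ht] at ht0 hmax'
      obtain ⟨c, hcx⟩ : ∃ c, c = T.A.anc t0 x0 := ⟨_, rfl⟩
      have hcy : c = T.A.anc t0 y0 := by rw [hcx, ht]; exact T.A.anc_lam x0 y0
      obtain ⟨f, hf⟩ : ∃ f : V → Option V, f = fun w =>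
        if T.A.anc t0 w = c then some (T.A.anc (t0+1) w) else none := ⟨_, rfl⟩
      obtain ⟨S, hSk, hS⟩ := T.outk c
      have himg : W.image f ⊆ Finset.insertNone S := by
        intro o ho
        rw [Finset.mem_image] at ho
        obtain ⟨w, hw, rfl⟩ := ho
        have hdw := hW w hw
        rw [hf]
        by_cases hwc : T.A.anc t0 w = c
        · simp only [hwc, if_true, Finset.some_mem_insertNone]
          have h1 := T.A.par_anc (x := w) (t := t0) (by omega)
          have h2 := T.A.dep_anc (x := w) (t := t0 + 1) (by omega)
          have h3 := T.A_edge (T.A.anc (t0+1) w) (T.A.ne_root (by omega))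
          rw [h1, hwc] at h3
          exact hS _ h3.1.symm h3.2
        · simp [hwc]
      have hcard : (W.image f).card ≤ k + 1 := by
        have := Finset.card_le_card himg
        rw [Finset.card_insertNone] at this
        omega
      have hmono : ∀ x ∈ W, ∀ y ∈ W, x ≠ y → f x = f y → T.D i x y ≠ M := by
        intro x hx y hy hxy hfxy hDM
        have hl := hmax' x hx y hy hxy hDM
        have hdx := hW x hx
        have hdy := hW y hy
        rw [hf] at hfxy
        simp only at hfxy
        by_cases hxc : T.A.anc t0 x = c
        · by_cases hyc : T.A.anc t0 y = c
          · simp only [hxc, hyc, if_true, Option.some.injEq] at hfxy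
            have := (T.A.le_lam_iff (x := x) (y := y) (t := t0+1) (by omega) (by omega)).2 hfxy
            omega
          · simp [hxc, hyc] at hfxy
        · by_cases hyc : T.A.anc t0 y = c
          · simp [hxc, hyc] at hfxy
          · have lt : ∀ a b, T.A.dep a = i → T.A.dep b = i → T.A.anc t0 a ≠ c →
                c = T.A.anc t0 b → T.A.lam a b < t0 := by
              intro a b ha hb hac hcb
              by_contra hcon
              have := (T.A.le_lam_iff (x := a) (y := b) (t := t0) (by omega) (by omega)).1
                (by omega)
              exact hac (by rw [this, hcb])
            have nn : ∀ a b, T.A.anc t0 a ≠ c → c = T.A.anc t0 b → a ≠ b := by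
              rintro a b h1 h2 rfl
              exact h1 h2.symm
            have l1 := lt x x0 hdx hdx0 hxc hcx
            have l2 := lt x y0 hdx hdy0 hxc hcy
            have l3 := lt y x0 hdy hdx0 hyc hcx
            have l4 := lt y y0 hdy hdy0 hyc hcy
            have d1 := hle x hx x0 hx0 (nn _ _ hxc hcx)
            have d2 := hle x hx y0 hy0 (nn _ _ hxc hcy)
            have d3 := hle y hy x0 hx0 (nn _ _ hyc hcx)
            have d4 := hle y hy y0 hy0 (nn _ _ hyc hcy)
            have a1 := T.D_add (y := x0) hdx
            have a2 := T.D_add (y := y0) hdx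
            have a3 := T.D_add (y := x0) hdy
            have a4 := T.D_add (y := y0) hdy
            have a5 := T.D_add (y := y) hdx
            have a6 := T.D_add (y := y0) hdx0
            have b4 := T.B.lam_four x y x0 y0
            have u1 := T.A.lam_ultra x x0 y0
            have u2 := T.A.lam_ultra x y0 x0
            have u3 := T.A.lam_ultra y x0 y0
            have u4 := T.A.lam_ultra y y0 x0
            have u5 := T.A.lam_ultra x x0 y
            rw [T.A.lam_comm y0 x0] at u2 u4
            rw [T.A.lam_comm x0 y] at u5
            omega
      have hfib : ∀ o ∈ W.image f, (W.filter fun w => f w = o).card ≤ (k+1) ^ m := by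
        intro o _
        apply ih
        · intro x hx
          exact hW x (Finset.mem_filter.1 hx).1
        · have hsub : ((W.filter fun w => f w = o).offDiag.image fun e => T.D i e.1 e.2) ⊆
              (W.offDiag.image fun e => T.D i e.1 e.2).erase M := by
            intro L hL
            rw [Finset.mem_image] at hL
            obtain ⟨⟨a, b⟩, hab, rfl⟩ := hL
            simp only [Finset.mem_offDiag, Finset.mem_filter] at hab
            obtain ⟨⟨ha, ha'⟩, ⟨hb, hb'⟩, hne'⟩ := hab
            rw [Finset.mem_erase]
            exact ⟨hmono a ha b hb hne' (by rw [ha', hb']), Finset.mem_image.2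
              ⟨(a, b), Finset.mem_offDiag.2 ⟨ha, hb, hne'⟩, rfl⟩⟩
          have := Finset.card_le_card hsub
          rw [Finset.card_erase_of_mem hMmem] at this
          omega
      calc W.card ≤ (k+1) ^ m * (W.image f).card := Finset.card_le_mul_card_image _ _ hfib
        _ ≤ (k+1) ^ m * (k+1) := Nat.mul_le_mul_left _ hcard
        _ = (k+1) ^ (m+1) := by rw [pow_succ]

end Lay

lemma Lay.card_le {V : Type*} {G : SimpleGraph V} {k : ℕ} (T : Lay G k) [Fintype V] :
    Fintype.card V ≤ 2 ^ ((cycLens G).ncard + 1) * (k + 1) ^ (cycLens G).ncard := by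
  classical
  have h1 : ∀ i ∈ (Finset.univ : Finset V).image T.A.dep,
      ((Finset.univ : Finset V).filter fun x => T.A.dep x = i).card ≤
        (k + 1) ^ (cycLens G).ncard := by
    intro i _
    apply T.layer_bound i
    · intro x hx
      exact (Finset.mem_filter.1 hx).2
    · rw [← Set.ncard_coe_finset]
      apply Set.ncard_le_ncard _ (cycLens_finite G)
      intro L hL
      rw [Finset.mem_coe, Finset.mem_image] at hL
      obtain ⟨⟨a, b⟩, hab, rfl⟩ := hL
      simp only [Finset.mem_offDiag, Finset.mem_filter, Finset.mem_univ, true_and] at hab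
      exact T.layer_cycle hab.1 hab.2.1 hab.2.2
  have h2 := Finset.card_le_mul_card_image _ _ h1
  have h3 : (Finset.univ : Finset V).image T.A.dep ⊆ Finset.range (T.ell + 1) := by
    intro j hj
    rw [Finset.mem_image] at hj
    obtain ⟨x, _, rfl⟩ := hj
    have := T.dep_le x
    simp; omega
  have h4 := Finset.card_le_card h3
  rw [Finset.card_range] at h4
  have h5 := T.ell_lt
  rw [Finset.card_univ] at h2
  calc _ ≤ _ := h2
    _ ≤ (k + 1) ^ (cycLens G).ncard * 2 ^ ((cycLens G).ncard + 1) :=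
        Nat.mul_le_mul_left _ (by omega)
    _ = _ := mul_comm _ _

open Finset in
lemma exists_lay {V : Type*} [Fintype V] [DecidableEq V] (G : SimpleGraph V)
    [DecidableRel G.Adj] (k : ℕ) (hk : 3 ≤ k) (hn : k + 1 ≤ Fintype.card V)
    (hedges : G.edgeFinset.card + k.choose 2 = (k - 1) * Fintype.card V + 1)
    (hcrit : ∀ S : Finset V, S.Nonempty → S ≠ Finset.univ →
      ∃ v ∈ S, (S.filter fun u => G.Adj v u).card < k) : Nonempty (Lay G k) := by
  obtain ⟨h, v, hinj, hmax, houtk, hin, hmin⟩ := crit_good_order G k hk hn hedges hcrit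
  obtain ⟨g, hg1, hg2⟩ := exists_potential (fun x y => G.Adj x y ∧ h y < h x)
    (fun x => h v - h x) (by
      rintro x y ⟨_, hxy⟩
      have := hmax x
      show h v - h x < h v - h y
      omega)
  obtain ⟨d, hd1, hd2⟩ := exists_potential (fun x y => G.Adj x y ∧ h x < h y) h
    (fun x y hxy => hxy.2)
  -- the sink
  obtain ⟨s, -, hs⟩ := Finset.exists_min_image univ h ⟨v, mem_univ v⟩
  have hs0 : h s = 0 := by
    by_contra hne
    have h1 := hmin s
    have h2 : (univ.filter fun y => G.Adj s y ∧ h y < h s).Nonempty := by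
      rw [← Finset.card_pos]; omega
    obtain ⟨y, hy⟩ := h2
    have := hs y (mem_univ y)
    simp only [mem_filter] at hy
    omega
  have hout : ∀ x, x ≠ s → ∃ y, G.Adj x y ∧ h y < h x := by
    intro x hx
    have h0 : h x ≠ 0 := fun h0 => hx (hinj (by rw [h0, hs0]))
    have h1 := hmin x
    have h2 : (univ.filter fun y => G.Adj x y ∧ h y < h x).Nonempty := by
      rw [← Finset.card_pos]; omega
    obtain ⟨y, hy⟩ := h2
    simp only [mem_filter, mem_univ, true_and] at hy
    exact ⟨y, hy⟩
  have hA : ∀ x, ∃ y, x ≠ v → (G.Adj y x ∧ h x < h y) ∧ g y + 1 = g x := by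
    intro x
    by_cases hx : x = v
    · exact ⟨x, fun h => absurd hx h⟩
    · rcases hg2 x with h0 | ⟨y, hy, he⟩
      · obtain ⟨y, hy1, hy2⟩ := hin x hx
        have := hg1 y x ⟨hy1.symm, hy2⟩
        omega
      · exact ⟨y, fun _ => ⟨hy, he⟩⟩
  have hB : ∀ x, ∃ y, x ≠ s → (G.Adj y x ∧ h y < h x) ∧ d y + 1 = d x := by
    intro x
    by_cases hx : x = s
    · exact ⟨x, fun h => absurd hx h⟩
    · rcases hd2 x with h0 | ⟨y, hy, he⟩
      · obtain ⟨y, hy1, hy2⟩ := hout x hx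
        have := hd1 y x ⟨hy1.symm, hy2⟩
        omega
      · exact ⟨y, fun _ => ⟨hy, he⟩⟩
  choose pA hpA using hA
  choose pB hpB using hB
  have gv : g v = 0 := by
    rcases hg2 v with h0 | ⟨y, hy, he⟩
    · exact h0
    · have := hmax y
      omega
  have ds : d s = 0 := by
    rcases hd2 s with h0 | ⟨y, hy, he⟩
    · exact h0
    · have := hy.2
      omega
  exact ⟨{
    h := h
    hinj := hinj
    A := ⟨pA, g, v, gv, fun x hx => (hpA x hx).2⟩
    B := ⟨pB, d, s, ds, fun x hx => (hpB x hx).2⟩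
    A_edge := fun x hx => ⟨(hpA x hx).1.1.symm, (hpA x hx).1.2⟩
    B_edge := fun x hx => ⟨(hpB x hx).1.1.symm, (hpB x hx).1.2⟩
    A_lt := fun x y hxy hlt => hg1 x y ⟨hxy, hlt⟩
    two := by
      intro x hx z
      have h1 := hmin x
      obtain ⟨y, hy, hyz⟩ := Finset.exists_mem_ne (by omega :
        1 < (univ.filter fun y => G.Adj x y ∧ h y < h x).card) z
      simp only [mem_filter, mem_univ, true_and] at hy
      exact ⟨y, hy.1, hy.2, hyz⟩
    outk := fun x => ⟨_, houtk x, fun y h1 h2 => by simp [h1, h2]⟩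
    hB := hs0 }⟩

/-- For `k ≥ 3` and `n ≥ k+1`, every degree `k`-critical graph on `n` vertices
contains cycles of at least `log₂ n / (3 + log₂ k) − 2` distinct lengths. -/
theorem stmt18 {V : Type*} [Fintype V] [DecidableEq V] (G : SimpleGraph V)
    [DecidableRel G.Adj] (k : ℕ) (hk : 3 ≤ k) (hn : k + 1 ≤ Fintype.card V)
    (hedges : G.edgeFinset.card + k.choose 2 = (k - 1) * Fintype.card V + 1)
    (hcrit : ∀ S : Finset V, S.Nonempty → S ≠ Finset.univ →
      ∃ v ∈ S, (S.filter fun u => G.Adj v u).card < k) :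
    Real.logb 2 (Fintype.card V : ℝ) / (3 + Real.logb 2 (k : ℝ)) - 2 ≤
      (({ L : ℕ | ∃ (v : V) (p : G.Walk v v), p.IsCycle ∧ p.length = L }).ncard : ℝ) := by
  obtain ⟨T⟩ := exists_lay G k hk hn hedges hcrit
  have hcard := T.card_le
  change _ ≤ ((cycLens G).ncard : ℝ)
  obtain ⟨r, hr⟩ : ∃ r, r = (cycLens G).ncard := ⟨_, rfl⟩
  rw [← hr] at hcard ⊢
  have hk3 : (3 : ℝ) ≤ k := by exact_mod_cast hk
  have hb : (1 : ℝ) < 2 := by norm_num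
  have hlogk : 0 ≤ Real.logb 2 (k : ℝ) := Real.logb_nonneg hb (by linarith)
  have hnpos : (0 : ℝ) < Fintype.card V := by
    have : 0 < Fintype.card V := by omega
    exact_mod_cast this
  have hcard2 : Fintype.card V ≤ 2 ^ (r + 1) * (2 * k) ^ r :=
    hcard.trans (Nat.mul_le_mul_left _ (Nat.pow_le_pow_left (by omega) _))
  have hcard3 : (Fintype.card V : ℝ) ≤ 2 ^ (r + 1) * (2 * k) ^ r := by exact_mod_cast hcard2
  have hlog := Real.logb_le_logb_of_le hb hnpos hcard3
  have hk0 : (k : ℝ) ≠ 0 := by linarith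
  rw [Real.logb_mul (by positivity) (by positivity), Real.logb_pow, Real.logb_pow,
    Real.logb_mul (by norm_num) hk0, Real.logb_self_eq_one hb] at hlog
  rw [sub_le_iff_le_add, div_le_iff₀ (by linarith)]
  push_cast at hlog
  have hr0 : (0 : ℝ) ≤ r := Nat.cast_nonneg r
  nlinarith [mul_nonneg hr0 hlogk]
end

section
/- For every N ≥ 1 sufficiently large and every even n ≥ 2^{N/2}, every 1–3 tree on n vertices contains leaf-to-leaf paths of at least Ω(N^{2/3}) distinct lengths between 0 and N; formally, there exists an absolute constant c > 0 such that every such tree has at least c·N^{2/3} distinct leaf-to-leaf path lengths in the interval [0, N]. -/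
namespace OneThree

/-- Full binary trees. -/
inductive BT : Type
  | leaf : BT
  | node : BT → BT → BT

/-- Height of a binary tree. -/
def BT.height : BT → ℕ
  | .leaf => 0
  | .node l r => max l.height r.height + 1

/-- Least depth of a leaf. -/
def BT.mu : BT → ℕ
  | .leaf => 0
  | .node l r => min l.mu r.mu + 1

/-- Number of vertices. -/
def BT.size : BT → ℕ
  | .leaf => 1
  | .node l r => l.size + r.size + 1

/-- Depths of leaves. -/
def BT.depth : BT → ℕ → Prop
  | .leaf, a => a = 0
  | .node l r, a => ∃ b, a = b + 1 ∧ (l.depth b ∨ r.depth b)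

/-- Lengths of leaf-to-leaf paths. -/
def BT.dist : BT → ℕ → Prop
  | .leaf, _ => False
  | .node l r, a => l.dist a ∨ r.dist a ∨ ∃ b c, l.depth b ∧ r.depth c ∧ a = b + c + 2

theorem BT.mu_depth (t : BT) : t.depth t.mu := by
  induction t with
  | leaf => rfl
  | node l r hl hr =>
    refine ⟨min l.mu r.mu, rfl, ?_⟩
    rcases min_choice l.mu r.mu with h | h <;> rw [h]
    · exact Or.inl hl
    · exact Or.inr hr

theorem BT.depth_le (t : BT) (a : ℕ) (h : t.depth a) : a ≤ t.height := by
  induction t generalizing a with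
  | leaf => exact le_of_eq h
  | node l r hl hr =>
    obtain ⟨b, rfl, h | h⟩ := h
    · have := hl b h; simp only [BT.height]; omega
    · have := hr b h; simp only [BT.height]; omega

theorem BT.dist_le (t : BT) (a : ℕ) (h : t.dist a) : a ≤ 2 * t.height := by
  induction t generalizing a with
  | leaf => exact h.elim
  | node l r hl hr =>
    obtain h | h | ⟨b, c, hb, hc, rfl⟩ := h
    · have := hl a h; simp only [BT.height]; omega
    · have := hr a h; simp only [BT.height]; omega
    · have := l.depth_le b hb
      have := r.depth_le c hc
      simp only [BT.height]; omega

theorem BT.dist_even (t : BT) (j : ℕ) (hj : 1 ≤ j) (h : j ≤ t.mu) : t.dist (2 * j) := by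
  induction t with
  | leaf => simp only [BT.mu] at h; omega
  | node l r hl hr =>
    simp only [BT.mu] at h
    by_cases h1 : j ≤ l.mu
    · exact Or.inl (hl h1)
    by_cases h2 : j ≤ r.mu
    · exact Or.inr (Or.inl (hr h2))
    exact Or.inr (Or.inr ⟨_, _, l.mu_depth, r.mu_depth, by omega⟩)

theorem BT.size_le (t : BT) : t.size + 1 ≤ 2 ^ (t.height + 1) := by
  induction t with
  | leaf => simp [BT.size, BT.height]
  | node l r hl hr =>
    simp only [BT.size, BT.height]
    have h1 : 2 ^ (l.height + 1) ≤ 2 ^ (max l.height r.height + 1) :=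
      Nat.pow_le_pow_right (by norm_num) (by omega)
    have h2 : 2 ^ (r.height + 1) ≤ 2 ^ (max l.height r.height + 1) :=
      Nat.pow_le_pow_right (by norm_num) (by omega)
    rw [pow_succ 2 (max l.height r.height + 1)]
    omega

theorem BT.exists_sub (t : BT) (h : ℕ) (hh : h ≤ t.height) :
    ∃ s : BT, s.height = h ∧ ∀ a, s.dist a → t.dist a := by
  induction t with
  | leaf => exact ⟨.leaf, by simp only [BT.height] at *; omega, fun _ h => h⟩
  | node l r hl hr =>
    by_cases h0 : h = (BT.node l r).height
    · exact ⟨_, h0.symm, fun _ h => h⟩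
    simp only [BT.height] at hh h0
    by_cases h1 : h ≤ l.height
    · obtain ⟨s, hs, hd⟩ := hl h1
      exact ⟨s, hs, fun a ha => Or.inl (hd a ha)⟩
    · obtain ⟨s, hs, hd⟩ := hr (by omega)
      exact ⟨s, hs, fun a ha => Or.inr (Or.inl (hd a ha))⟩

/-- The data along a longest root-to-leaf path. -/
def Spine (dep dis : ℕ → Prop) (h : ℕ) (d : ℕ → ℕ) : Prop :=
  dep h ∧ ∀ i, 1 ≤ i → i ≤ h → 1 ≤ d i ∧ dep (h - i + d i) ∧ dis (i + d i) ∧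
    (∀ j, 1 ≤ j → j + 1 ≤ d i → dis (2 * j)) ∧
    (∀ j, i < j → j ≤ h → dis (d i + d j + (j - i)))

theorem spine_step (l r : BT) (d : ℕ → ℕ) (h : ℕ) (hs : Spine l.depth l.dist h d)
    (dep dis : ℕ → Prop) (h1 : ∀ a, l.depth a → dep (a + 1)) (h2 : ∀ a, r.depth a → dep (a + 1))
    (h3 : ∀ a, l.dist a → dis a) (h4 : ∀ a, r.dist a → dis a)
    (h5 : ∀ a b, l.depth a → r.depth b → dis (a + b + 2)) :
    ∃ d', Spine dep dis (h + 1) d' := by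
  obtain ⟨hd, hs⟩ := hs
  refine ⟨fun i => if i = h + 1 then r.mu + 1 else d i, h1 _ hd, ?_⟩
  intro i hi1 hi2
  by_cases hi : i = h + 1
  · subst hi
    simp only [if_true]
    refine ⟨by omega, ?_, ?_, ?_, ?_⟩
    · have := h2 _ r.mu_depth
      convert this using 1; omega
    · have := h5 _ _ hd r.mu_depth
      convert this using 1; omega
    · intro j hj1 hj2
      exact h4 _ (r.dist_even j hj1 (by omega))
    · intro j hj1 hj2; omega
  · obtain ⟨k1, k2, k3, k4, k5⟩ := hs i hi1 (by omega)
    simp only [if_neg hi]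
    refine ⟨k1, ?_, h3 _ k3, fun j hj1 hj2 => h3 _ (k4 j hj1 hj2), ?_⟩
    · have := h1 _ k2
      convert this using 1; omega
    · intro j hj1 hj2
      by_cases hj : j = h + 1
      · subst hj
        simp only [if_true]
        have := h5 _ _ k2 r.mu_depth
        convert this using 1; omega
      · simp only [if_neg hj]
        exact h3 _ (k5 j hj1 (by omega))

theorem BT.exists_spine (t : BT) : ∃ d, Spine t.depth t.dist t.height d := by
  induction t with
  | leaf => exact ⟨fun _ => 1, rfl, fun i h1 h2 => by simp only [BT.height] at h2; omega⟩
  | node l r hl hr =>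
    by_cases h : r.height ≤ l.height
    · obtain ⟨d, hd⟩ := hl
      have : (BT.node l r).height = l.height + 1 := by simp only [BT.height]; omega
      rw [this]
      exact spine_step l r d _ hd _ _ (fun a ha => ⟨a, rfl, Or.inl ha⟩)
        (fun a ha => ⟨a, rfl, Or.inr ha⟩) (fun a ha => Or.inl ha) (fun a ha => Or.inr (Or.inl ha))
        (fun a b ha hb => Or.inr (Or.inr ⟨a, b, ha, hb, rfl⟩))
    · obtain ⟨d, hd⟩ := hr
      have : (BT.node l r).height = r.height + 1 := by simp only [BT.height]; omega
      rw [this]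
      exact spine_step r l d _ hd _ _ (fun a ha => ⟨a, rfl, Or.inr ha⟩)
        (fun a ha => ⟨a, rfl, Or.inl ha⟩) (fun a ha => Or.inr (Or.inl ha)) (fun a ha => Or.inl ha)
        (fun a b ha hb => Or.inr (Or.inr ⟨b, a, hb, ha, by omega⟩))

/-- Counting over windows. -/
theorem window_sum (n m T : ℕ) (hm : 1 ≤ m) (hT : 2 * m * T ≤ n) (d : ℕ → ℕ)
    (hd : ∀ i < n, d i ≤ m) :
    ∑ t ∈ Finset.range T,
      ((Finset.Ico (2 * m * t) (2 * m * t + m)).image (fun i => i + d i)).card ≤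
      ((Finset.range n).image (fun i => i + d i)).card := by
  rw [← Finset.card_biUnion]
  · apply Finset.card_le_card
    intro x hx
    simp only [Finset.mem_biUnion, Finset.mem_image, Finset.mem_Ico, Finset.mem_range] at hx ⊢
    obtain ⟨t, ht, i, hi, rfl⟩ := hx
    have : 2 * m * (t + 1) ≤ 2 * m * T := Nat.mul_le_mul_left _ ht
    exact ⟨i, by rw [mul_add] at this; omega, rfl⟩
  · intro s hs t ht hst
    rw [Function.onFun, Finset.disjoint_left]
    intro x hx hy
    apply hst
    have key : ∀ t ∈ Finset.range T,
        x ∈ (Finset.Ico (2 * m * t) (2 * m * t + m)).image (fun i => i + d i) →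
        x / (2 * m) = t := by
      intro t ht hx
      simp only [Finset.mem_image, Finset.mem_Ico, Finset.mem_range] at hx ht
      obtain ⟨i, hi, rfl⟩ := hx
      have : 2 * m * (t + 1) ≤ 2 * m * T := Nat.mul_le_mul_left _ ht
      have hdi := hd i (by rw [mul_add] at this; omega)
      rw [Nat.div_eq_iff (by omega)]
      rw [mul_comm t]
      omega
    rw [← key s hs hx, ← key t ht hy]

theorem comb (n m : ℕ) (hm : 1 ≤ m) (d : ℕ → ℕ) (hd : ∀ i < n, d i ≤ m)
    (hA : ((Finset.range n).image (fun i => i + (m - d i))).card ≤ m)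
    (hB : ((Finset.range n).image (fun i => i + d i)).card ≤ m) :
    n ^ 2 ≤ 324 * m ^ 3 := by
  set T := n / (2 * m) with hTdef
  have hT : 2 * m * T ≤ n := Nat.mul_div_le _ _
  have hT' : n < 2 * m * (T + 1) := by
    exact Nat.lt_mul_div_succ n (by omega)
  set s := Nat.sqrt m with hs
  have hs1 : s * s ≤ m := Nat.sqrt_le m
  have hs2 : m < (s + 1) * (s + 1) := Nat.lt_succ_sqrt m
  have hs0 : 1 ≤ s := Nat.sqrt_pos.2 hm
  have w1 := window_sum n m T hm hT d hd
  have w2 := window_sum n m T hm hT (fun i => m - d i) (fun i _ => by omega)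
  have w3 : T * s ≤ ∑ t ∈ Finset.range T,
      (((Finset.Ico (2 * m * t) (2 * m * t + m)).image (fun i => i + d i)).card +
       ((Finset.Ico (2 * m * t) (2 * m * t + m)).image (fun i => i + (m - d i))).card) := by
    have : T * s = ∑ t ∈ Finset.range T, s := by simp
    rw [this]
    apply Finset.sum_le_sum
    intro t ht
    by_contra hlt
    push Not at hlt
    have hc : (Finset.Ico (2 * m * t) (2 * m * t + m)).card ≤
        (((Finset.Ico (2 * m * t) (2 * m * t + m)).image (fun i => i + d i)) ×ˢ
       ((Finset.Ico (2 * m * t) (2 * m * t + m)).image (fun i => i + (m - d i)))).card := by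
      apply Finset.card_le_card_of_injOn (fun i => (i + d i, i + (m - d i)))
      · intro i hi
        exact Finset.mem_product.2
          ⟨Finset.mem_image_of_mem _ hi, Finset.mem_image_of_mem (fun i => i + (m - d i)) hi⟩
      · intro i hi j hj hij
        simp only [Finset.coe_Ico, Set.mem_Ico, Prod.mk.injEq, Finset.mem_range] at hi hj hij ht
        have : 2 * m * (t + 1) ≤ 2 * m * T := Nat.mul_le_mul_left _ ht
        rw [mul_add] at this
        have hdi := hd i (by omega)
        have hdj := hd j (by omega)
        omega
    rw [Finset.card_product, Nat.card_Ico, Nat.add_sub_cancel_left] at hc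
    generalize Finset.card _ = α at hc hlt
    generalize Finset.card _ = β at hc hlt
    have : α * β < s * s := Nat.mul_lt_mul'' (by omega) (by omega)
    omega
  rw [Finset.sum_add_distrib] at w3
  have w4 : T * s ≤ 2 * m := by omega
  have w5 : T ≤ 8 * s := by
    have : T * s ≤ (8 * s) * s := by nlinarith
    exact Nat.le_of_mul_le_mul_right this hs0
  have w6 : n ≤ 18 * (m * s) := by nlinarith
  calc n ^ 2 ≤ (18 * (m * s)) ^ 2 := Nat.pow_le_pow_left w6 2
    _ = 324 * m ^ 2 * (s * s) := by ring
    _ ≤ 324 * m ^ 2 * m := Nat.mul_le_mul_left _ hs1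
    _ = _ := by ring

theorem BT.main (t : BT) (D : Set ℕ) (hD : D.Finite) (h : ∀ a, t.dist a → a ∈ D) :
    (t.height - 1) ^ 2 ≤ 324 * (D.ncard + 1) ^ 3 := by
  obtain ⟨d, -, hs⟩ := t.exists_spine
  set H := t.height
  have hle : ∀ i, 1 ≤ i → i ≤ H → d i ≤ D.ncard + 1 := by
    intro i h1 h2
    obtain ⟨-, -, -, k, -⟩ := hs i h1 h2
    have : ((Finset.Ico 1 (d i)).image (fun j => 2 * j)).card ≤ D.ncard := by
      rw [← Set.ncard_coe_finset]
      apply Set.ncard_le_ncard _ hD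
      intro x hx
      simp only [Finset.coe_image, Set.mem_image, Finset.mem_coe, Finset.mem_Ico] at hx
      obtain ⟨j, hj, rfl⟩ := hx
      exact h _ (k j hj.1 hj.2)
    rw [Finset.card_image_of_injective _ (fun a b hab => by simpa using hab), Nat.card_Ico] at this
    omega
  apply comb (H - 1) (D.ncard + 1) (by omega) (fun i => d (i + 1))
  · intro i hi
    exact hle _ (by omega) (by omega)
  · refine le_trans ?_ (Nat.le_succ _)
    rw [← Set.ncard_coe_finset]
    apply Set.ncard_le_ncard_of_injOn (fun x => d H + H + (D.ncard + 1) - 1 - x) _ _ hD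
    · intro x hx
      simp only [Finset.coe_image, Set.mem_image, Finset.mem_coe, Finset.mem_range] at hx
      obtain ⟨i, hi, rfl⟩ := hx
      have h1 := (hs (i + 1) (by omega) (by omega)).2.2.2.2 H (by omega) le_rfl
      have h2 := hle (i + 1) (by omega) (by omega)
      have h3 := h _ h1
      show _ ∈ D
      convert h3 using 1
      omega
    · intro x hx y hy hxy
      simp only [Finset.coe_image, Set.mem_image, Finset.mem_coe, Finset.mem_range] at hx hy
      obtain ⟨i, hi, rfl⟩ := hx
      obtain ⟨j, hj, rfl⟩ := hy
      have h2 := hle (i + 1) (by omega) (by omega)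
      have h3 := hle (j + 1) (by omega) (by omega)
      simp only at hxy
      omega
  · refine le_trans ?_ (Nat.le_succ _)
    rw [← Set.ncard_coe_finset]
    apply Set.ncard_le_ncard_of_injOn (fun x => x + 1) _ _ hD
    · intro x hx
      simp only [Finset.coe_image, Set.mem_image, Finset.mem_coe, Finset.mem_range] at hx
      obtain ⟨i, hi, rfl⟩ := hx
      have h1 := (hs (i + 1) (by omega) (by omega)).2.2.1
      have h3 := h _ h1
      show _ ∈ D
      convert h3 using 1
      omega
    · intro x hx y hy hxy
      simpa using hxy

/-! ### Graph part -/

/-- The branch of `G` beyond the dart `u → v` is the binary tree `t`. -/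
inductive Br {V : Type} (G : SimpleGraph V) : V → V → BT → Prop
  | leaf (u v : V) : G.Adj u v → (∀ z, G.Adj v z → z = u) → Br G u v .leaf
  | node (u v x y : V) (l r : BT) : G.Adj u v → G.Adj v x → G.Adj v y → x ≠ u → y ≠ u → x ≠ y →
      (∀ z, G.Adj v z → z = u ∨ z = x ∨ z = y) → Br G v x l → Br G v y r →
      Br G u v (.node l r)

/-- A path that starts with the dart `u → v` and ends in a leaf. -/
def PP {V : Type} (G : SimpleGraph V) (u v : V) (a : ℕ) : Prop :=
  ∃ (h : G.Adj u v) (w : V) (q : G.Walk v w), (SimpleGraph.Walk.cons h q).IsPath ∧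
    (∃ z, ∀ z', G.Adj w z' ↔ z' = z) ∧ q.length = a

/-- A leaf-to-leaf path length. -/
def LL {V : Type} (G : SimpleGraph V) (a : ℕ) : Prop :=
  ∃ (u v : V) (p : G.Walk u v), p.IsPath ∧ (∃ z, ∀ z', G.Adj u z' ↔ z' = z) ∧
    (∃ z, ∀ z', G.Adj v z' ↔ z' = z) ∧ p.length = a

theorem PP.step {V : Type} {G : SimpleGraph V} (hG : G.IsAcyclic) {u v x : V} {a : ℕ}
    (huv : G.Adj u v) (hx : x ≠ u) (h : PP G v x a) : PP G u v (a + 1) := by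
  obtain ⟨hvx, w, q, hq, hw, rfl⟩ := h
  refine ⟨huv, w, .cons hvx q, ?_, hw, by simp⟩
  rw [hG.isPath_iff_isChain] at hq ⊢
  simp only [SimpleGraph.Walk.edges_cons] at hq ⊢
  refine List.IsChain.cons_cons ?_ hq
  intro he
  simp only [Sym2.eq_iff] at he
  rcases he with ⟨h1, h2⟩ | ⟨h1, h2⟩
  · exact huv.ne h1
  · exact hx h1.symm

theorem PP.join {V : Type} {G : SimpleGraph V} (hG : G.IsAcyclic) {v x y : V} {a b : ℕ}
    (hxy : x ≠ y) (h : PP G v x a) (h' : PP G v y b) : LL G (a + b + 2) := by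
  obtain ⟨hvx, w, q, hq, hw, rfl⟩ := h
  obtain ⟨hvy, w', q', hq', hw', rfl⟩ := h'
  refine ⟨w, w', (SimpleGraph.Walk.cons hvx q).reverse.append (.cons hvy q'), ?_, hw, hw', ?_⟩
  · have hqr := hq.reverse
    rw [hG.isPath_iff_isChain] at hqr hq' ⊢
    rw [SimpleGraph.Walk.edges_append, List.isChain_append]
    refine ⟨hqr, hq', ?_⟩
    intro e he f hf
    simp only [SimpleGraph.Walk.edges_reverse, SimpleGraph.Walk.edges_cons, List.getLast?_reverse,
      List.head?_cons, Option.mem_def, Option.some.injEq] at he hf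
    subst he hf
    intro he
    simp only [Sym2.eq_iff] at he
    rcases he with ⟨h1, h2⟩ | ⟨h1, h2⟩
    · exact hxy h2
    · exact hvy.ne h1
  · simp; omega

theorem Br.depth {V : Type} {G : SimpleGraph V} (hG : G.IsAcyclic) {u v : V} {t : BT}
    (h : Br G u v t) : ∀ a, t.depth a → PP G u v a := by
  induction h with
  | leaf u v h1 h2 =>
    intro a ha
    have ha : a = 0 := ha
    subst ha
    refine ⟨h1, v, .nil, ?_, ⟨u, fun z => ⟨h2 z, fun h => h ▸ h1.symm⟩⟩, rfl⟩
    rw [hG.isPath_iff_isChain]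
    simp
  | node u v x y l r h1 h2 h3 h4 h5 h6 h7 h8 h9 ihl ihr =>
    rintro a ⟨b, rfl, hb | hb⟩
    · exact PP.step hG h1 h4 (ihl b hb)
    · exact PP.step hG h1 h5 (ihr b hb)

theorem Br.dist {V : Type} {G : SimpleGraph V} (hG : G.IsAcyclic) {u v : V} {t : BT}
    (h : Br G u v t) : ∀ a, t.dist a → LL G a := by
  induction h with
  | leaf u v h1 h2 => intro a ha; exact ha.elim
  | node u v x y l r h1 h2 h3 h4 h5 h6 h7 h8 h9 ihl ihr =>
    rintro a (ha | ha | ⟨b, c, hb, hc, rfl⟩)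
    · exact ihl a ha
    · exact ihr a ha
    · exact PP.join hG h6 (h8.depth hG b hb) (h9.depth hG c hc)

theorem Br.cover {V : Type} [DecidableEq V] {G : SimpleGraph V} {u v : V} {t : BT}
    (h : Br G u v t) : ∃ S : Finset V, v ∈ S ∧ S.card ≤ t.size ∧
      ∀ x ∈ S, ∀ y, G.Adj x y → y ∈ S ∨ y = u := by
  induction h with
  | leaf u v h1 h2 =>
    refine ⟨{v}, by simp, by simp [BT.size], ?_⟩
    intro x hx y hxy
    rw [Finset.mem_singleton] at hx
    subst hx
    exact Or.inr (h2 y hxy)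
  | node u v x y l r h1 h2 h3 h4 h5 h6 h7 h8 h9 ihl ihr =>
    obtain ⟨S, hS1, hS2, hS3⟩ := ihl
    obtain ⟨S', hS1', hS2', hS3'⟩ := ihr
    refine ⟨insert v (S ∪ S'), by simp, ?_, ?_⟩
    · have := Finset.card_insert_le v (S ∪ S')
      have := Finset.card_union_le S S'
      simp only [BT.size]; omega
    · intro z hz w hzw
      simp only [Finset.mem_insert, Finset.mem_union] at hz ⊢
      rcases hz with rfl | hz | hz
      · rcases h7 w hzw with rfl | rfl | rfl <;> simp [hS1, hS1']
      · rcases hS3 z hz w hzw with h | h <;> simp [h]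
      · rcases hS3' z hz w hzw with h | h <;> simp [h]

theorem exists_br {V : Type} {G : SimpleGraph V} (hG : G.IsAcyclic)
    (hdeg : ∀ v u, G.Adj v u → (∀ z, G.Adj v z → z = u) ∨ ∃ x y, G.Adj v x ∧ G.Adj v y ∧ x ≠ u ∧
      y ≠ u ∧ x ≠ y ∧ ∀ z, G.Adj v z → z = u ∨ z = x ∨ z = y) (k : ℕ) :
    ∀ (u v : V) (h : G.Adj u v), (∀ w (q : G.Walk v w), (SimpleGraph.Walk.cons h q).IsPath →
      q.length < k) → ∃ t, Br G u v t := by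
  induction k with
  | zero =>
    intro u v h hk
    have := hk v .nil (by rw [hG.isPath_iff_isChain]; simp)
    omega
  | succ k ih =>
    intro u v h hk
    rcases hdeg v u h.symm with h1 | ⟨x, y, h2, h3, h4, h5, h6, h7⟩
    · exact ⟨_, Br.leaf u v h h1⟩
    · have key : ∀ x, (hx : G.Adj v x) → x ≠ u → ∃ t, Br G v x t := by
        intro x hx hxu
        apply ih v x hx
        intro w q hq
        have : (SimpleGraph.Walk.cons h (.cons hx q)).IsPath := by
          rw [hG.isPath_iff_isChain] at hq ⊢
          simp only [SimpleGraph.Walk.edges_cons] at hq ⊢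
          refine List.IsChain.cons_cons ?_ hq
          intro he
          simp only [Sym2.eq_iff] at he
          rcases he with ⟨h1, h2⟩ | ⟨h1, h2⟩
          · exact h.ne h1
          · exact hxu h1.symm
        have := hk _ _ this
        simp only [SimpleGraph.Walk.length_cons] at this
        omega
      obtain ⟨l, hl⟩ := key x h2 h4
      obtain ⟨r, hr⟩ := key y h3 h5
      exact ⟨_, Br.node u v x y l r h h2 h3 h4 h5 h6 h7 hl hr⟩

theorem deg_split {V : Type} [Fintype V] (G : SimpleGraph V) [DecidableRel G.Adj]
    (hdeg : ∀ v : V, G.degree v = 1 ∨ G.degree v = 3) (v u : V) (h : G.Adj v u) :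
    (∀ z, G.Adj v z → z = u) ∨ ∃ x y, G.Adj v x ∧ G.Adj v y ∧ x ≠ u ∧
      y ≠ u ∧ x ≠ y ∧ ∀ z, G.Adj v z → z = u ∨ z = x ∨ z = y := by
  classical
  have hu : u ∈ G.neighborFinset v := by simpa using h
  rcases hdeg v with hv | hv
  · left
    intro z hz
    have hz' : z ∈ G.neighborFinset v := by simpa using hz
    exact Finset.card_le_one.1 (le_of_eq hv) z hz' u hu
  · right
    have hc : ((G.neighborFinset v).erase u).card = 2 := by
      rw [Finset.card_erase_of_mem hu]
      have : (G.neighborFinset v).card = 3 := hv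
      omega
    obtain ⟨x, y, hxy, he⟩ := Finset.card_eq_two.1 hc
    have hm : ∀ z, z ∈ (G.neighborFinset v).erase u ↔ z = x ∨ z = y := by
      intro z; rw [he]; simp
    simp only [Finset.mem_erase, SimpleGraph.mem_neighborFinset] at hm
    have hx := (hm x).2 (Or.inl rfl)
    have hy := (hm y).2 (Or.inr rfl)
    refine ⟨x, y, hx.2, hy.2, hx.1, hy.1, hxy, ?_⟩
    intro z hz
    by_cases hzu : z = u
    · exact Or.inl hzu
    · exact Or.inr ((hm z).1 ⟨hzu, hz⟩)

theorem exists_tall {V : Type} [Fintype V] (G : SimpleGraph V) [DecidableRel G.Adj]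
    (hG : G.IsTree) (hdeg : ∀ v : V, G.degree v = 1 ∨ G.degree v = 3) :
    ∃ u v t, Br G u v t ∧ Fintype.card V ≤ 2 ^ (t.height + 2) := by
  classical
  obtain ⟨u⟩ := hG.1.nonempty
  have hu : 0 < G.degree u := by rcases hdeg u with h | h <;> omega
  obtain ⟨v, huv⟩ := (G.degree_pos_iff_exists_adj u).1 hu
  have ex : ∀ u v, G.Adj u v → ∃ t, Br G u v t := by
    intro u v h
    apply exists_br hG.2 (deg_split G hdeg) (Fintype.card V) u v h
    intro w q hq
    have := hq.length_lt
    simp only [SimpleGraph.Walk.length_cons] at this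
    omega
  obtain ⟨t, ht⟩ := ex u v huv
  obtain ⟨t', ht'⟩ := ex v u huv.symm
  obtain ⟨S, h1, h2, h3⟩ := ht.cover
  obtain ⟨S', h1', h2', h3'⟩ := ht'.cover
  have hall : ∀ w, w ∈ S ∪ S' := by
    intro w
    obtain ⟨p⟩ := hG.1.preconnected u w
    have : ∀ a b (p : G.Walk a b), a ∈ S ∪ S' → b ∈ S ∪ S' := by
      intro a b p
      induction p with
      | nil => exact id
      | cons hab q ih =>
        intro ha
        apply ih
        rw [Finset.mem_union] at ha ⊢
        rcases ha with ha | ha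
        · rcases h3 _ ha _ hab with h | h
          · exact Or.inl h
          · subst h; exact Or.inr h1'
        · rcases h3' _ ha _ hab with h | h
          · exact Or.inr h
          · subst h; exact Or.inl h1
    exact this u w p (Finset.mem_union_right _ h1')
  have hc : Fintype.card V ≤ t.size + t'.size := by
    rw [← Finset.card_univ, ← (Finset.eq_univ_iff_forall.2 hall)]
    exact (Finset.card_union_le _ _).trans (by omega)
  have s1 := t.size_le
  have s2 := t'.size_le
  rcases le_total t.size t'.size with h | h
  · exact ⟨v, u, t', ht', by rw [pow_succ]; omega⟩
  · exact ⟨u, v, t, ht, by rw [pow_succ]; omega⟩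

theorem leaf_degree {V : Type} [Fintype V] (G : SimpleGraph V) [DecidableRel G.Adj] (w : V)
    (h : ∃ z, ∀ z', G.Adj w z' ↔ z' = z) : G.degree w = 1 := by
  rw [SimpleGraph.degree_eq_one_iff_existsUnique_adj]
  obtain ⟨z, hz⟩ := h
  exact ⟨z, (hz z).2 rfl, fun y hy => (hz y).1 hy⟩

end OneThree


/-- There is an absolute constant `c > 0` such that for all sufficiently
large `N` and all even `n ≥ 2^{N/2}`, every 1–3 tree on `n` vertices has at
least `c·N^{2/3}` distinct leaf-to-leaf path lengths in `[0, N]`. -/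
theorem stmt19 :
    ∃ c : ℝ, 0 < c ∧ ∃ N₀ : ℕ, ∀ N : ℕ, N₀ ≤ N →
      ∀ (V : Type) [Fintype V] (G : SimpleGraph V) [DecidableRel G.Adj],
        G.IsTree → (∀ v : V, G.degree v = 1 ∨ G.degree v = 3) →
        Even (Fintype.card V) →
        (2 : ℝ) ^ ((N : ℝ) / 2) ≤ (Fintype.card V : ℝ) →
        c * (N : ℝ) ^ ((2 : ℝ) / 3) ≤
          (({ L : ℕ | L ≤ N ∧ ∃ (u v : V) (p : G.Walk u v), p.IsPath ∧
              G.degree u = 1 ∧ G.degree v = 1 ∧ p.length = L }).ncard : ℝ) := by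
  refine ⟨1 / 40, by norm_num, 100, ?_⟩
  intro N hN V _ G _ hG hdeg _ hcard
  set D : Set ℕ := { L : ℕ | L ≤ N ∧ ∃ (u v : V) (p : G.Walk u v), p.IsPath ∧
              G.degree u = 1 ∧ G.degree v = 1 ∧ p.length = L } with hD
  obtain ⟨u, v, t, ht, hc⟩ := OneThree.exists_tall G hG hdeg
  have hheight : (N : ℝ) / 2 ≤ ((t.height + 2 : ℕ) : ℝ) := by
    have h1 : (2 : ℝ) ^ ((N : ℝ) / 2) ≤ (2 : ℝ) ^ ((t.height + 2 : ℕ) : ℝ) := by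
      rw [Real.rpow_natCast]
      exact hcard.trans (by exact_mod_cast hc)
    exact (Real.rpow_le_rpow_left_iff (by norm_num)).1 h1
  have hheight' : N ≤ 2 * (t.height + 2) := by
    have : (N : ℝ) ≤ ((2 * (t.height + 2) : ℕ) : ℝ) := by push_cast at hheight ⊢; linarith
    exact_mod_cast this
  obtain ⟨s, hs, hsd⟩ := t.exists_sub (N / 2 - 2) (by omega)
  have hfin : D.Finite := (Set.finite_Iic N).subset (fun x hx => hx.1)
  have hmain := s.main D hfin (by
    intro a ha
    have hle := s.dist_le a ha
    obtain ⟨x, y, p, hp, hx, hy, hl⟩ := ht.dist hG.2 a (hsd a ha)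
    exact ⟨by omega, x, y, p, hp, OneThree.leaf_degree G x hx, OneThree.leaf_degree G y hy, hl⟩)
  rw [hs] at hmain
  generalize D.ncard = k at hmain ⊢
  obtain ⟨m, hm⟩ : ∃ m, m = N / 2 - 2 - 1 := ⟨_, rfl⟩
  rw [← hm] at hmain
  have hm4 : N ≤ 4 * m := by omega
  have hk : 1 ≤ k := by
    by_contra h0
    have : k = 0 := by omega
    subst this
    nlinarith
  have hcube : N ^ 2 ≤ (40 * k) ^ 3 := by
    have h1 : (k + 1) ^ 3 ≤ (2 * k) ^ 3 := Nat.pow_le_pow_left (by omega) 3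
    have h2 : N ^ 2 ≤ (4 * m) ^ 2 := Nat.pow_le_pow_left hm4 2
    calc N ^ 2 ≤ 16 * m ^ 2 := by rw [mul_pow] at h2; exact h2
      _ ≤ 16 * (324 * (2 * k) ^ 3) := by omega
      _ = 41472 * k ^ 3 := by ring
      _ ≤ 64000 * k ^ 3 := Nat.mul_le_mul_right _ (by norm_num)
      _ = _ := by ring
  have hreal : (N : ℝ) ^ ((2 : ℝ) / 3) ≤ 40 * k := by
    have h1 : ((N : ℝ) ^ 2) ≤ (40 * (k : ℝ)) ^ 3 := by exact_mod_cast hcube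
    have h2 : ((N : ℝ) ^ 2) ^ ((1 : ℝ) / 3) ≤ ((40 * (k : ℝ)) ^ 3) ^ ((1 : ℝ) / 3) :=
      Real.rpow_le_rpow (by positivity) h1 (by norm_num)
    rw [← Real.rpow_natCast, ← Real.rpow_natCast, ← Real.rpow_mul (by positivity),
      ← Real.rpow_mul (by positivity)] at h2
    norm_num at h2
    exact h2
  linarith
end
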